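/- arXiv:1702.03148 — 3 statements merged into one kernel-verified Lean document; each statement's English description precedes it below -/
import Mathlib

section
/- Let $d \ge 1$, $0 < s < 1$, and let $u$ be a Schwartz function on $\mathbb{R}^d$ and $\varphi : \mathbb{R}^d \to \mathbb{R}$ a smooth function whose partial derivatives of every order from $1$ to $4$ are bounded. Then $2\,\mathrm{Re}\int_{\mathbb{R}^d} \overline{(-\Delta)^s u}\,(\nabla u \cdot \nabla\varphi)\,dx \;-\; 2\,\mathrm{Re}\int_{\mathbb{R}^d} \bar u\,\big(\nabla((-\Delta)^s u) \cdot \nabla\varphi\big)\,dx \;=\; \int_0^\infty \lambda^s \left( \int_{\mathbb{R}^d} \Big( 4 \sum_{j,k=1}^d \partial_j\partial_k\varphi\;\partial_j \overline{u_\lambda}\;\partial_k u_\lambda \;-\; \Delta^2\varphi\, |u_\lambda|^2 \Big) dx \right) d\lambda$. -/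
open MeasureTheory Complex
open scoped ENNReal BigOperators RealInnerProductSpace

noncomputable section

abbrev Ed (d : ℕ) := EuclideanSpace ℝ (Fin d)

/-- Fourier transform with convention `(𝓕 f) ξ = ∫ e^{-i x·ξ} f x dx`. -/
def FT {d : ℕ} (f : Ed d → ℂ) (ξ : Ed d) : ℂ :=
  ∫ x : Ed d, Complex.exp (-Complex.I * ((⟪x, ξ⟫ : ℝ) : ℂ)) * f x

/-- Inverse Fourier transform `(2π)^{-d} ∫ e^{i x·ξ} g ξ dξ`. -/
def FTinv {d : ℕ} (g : Ed d → ℂ) (x : Ed d) : ℂ :=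
  (((2 * Real.pi) ^ (-(d : ℝ)) : ℝ) : ℂ) *
    ∫ ξ : Ed d, Complex.exp (Complex.I * ((⟪x, ξ⟫ : ℝ) : ℂ)) * g ξ

/-- Fractional Schrödinger propagator `e^{-it(-Δ)^s}`. -/
def fprop {d : ℕ} (s t : ℝ) (f : Ed d → ℂ) : Ed d → ℂ :=
  FTinv (fun ξ => Complex.exp (-Complex.I * (t : ℂ) * ((‖ξ‖ ^ (2 * s) : ℝ) : ℂ)) * FT f ξ)

/-- Fractional derivative `D^σ = (-Δ)^{σ/2}`, the Fourier multiplier `|ξ|^σ`. -/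
def fracD {d : ℕ} (σ : ℝ) (f : Ed d → ℂ) : Ed d → ℂ :=
  FTinv (fun ξ => ((‖ξ‖ ^ σ : ℝ) : ℂ) * FT f ξ)

/-- `(-Δ)^{β/2} e^{-it(-Δ)^s}`. -/
def fracDProp {d : ℕ} (β s t : ℝ) (f : Ed d → ℂ) : Ed d → ℂ :=
  FTinv (fun ξ => ((‖ξ‖ ^ β : ℝ) : ℂ) *
    Complex.exp (-Complex.I * (t : ℂ) * ((‖ξ‖ ^ (2 * s) : ℝ) : ℂ)) * FT f ξ)

/-- Resolvent `(-Δ + λ)⁻¹`. -/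
def resolv {d : ℕ} (lam : ℝ) (f : Ed d → ℂ) : Ed d → ℂ :=
  FTinv (fun ξ => FT f ξ / ((‖ξ‖ ^ 2 + lam : ℝ) : ℂ))

/-- Resolvent-regularization `u_λ = √(sin(πs)/π) (-Δ+λ)⁻¹ u`. -/
def reg {d : ℕ} (s lam : ℝ) (f : Ed d → ℂ) : Ed d → ℂ :=
  fun x => ((Real.sqrt (Real.sin (Real.pi * s) / Real.pi) : ℝ) : ℂ) * resolv lam f x

/-- A function is radial if its value depends only on `|x|`. -/
def IsRadial {d : ℕ} (f : Ed d → ℂ) : Prop :=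
  ∀ x y : Ed d, ‖x‖ = ‖y‖ → f x = f y

/-- Homogeneous Sobolev norm `‖f‖_{Ḣ^s} = (2π)^{-d/2} ‖ |ξ|^s 𝓕f ‖_{L²}`. -/
def HdotNorm {d : ℕ} (s : ℝ) (f : Ed d → ℂ) : ℝ :=
  (2 * Real.pi) ^ (-(d : ℝ) / 2) *
    (eLpNorm (fun ξ : Ed d => ((‖ξ‖ ^ s : ℝ) : ℂ) * FT f ξ) 2 volume).toReal

/-- Inhomogeneous Sobolev norm `‖f‖_{H^s}² = ‖f‖_{L²}² + ‖f‖_{Ḣ^s}²`. -/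
def HNorm {d : ℕ} (s : ℝ) (f : Ed d → ℂ) : ℝ :=
  Real.sqrt ((eLpNorm f 2 volume).toReal ^ 2 + HdotNorm s f ^ 2)

/-- Mixed space-time norm `L^q_t L^r_x (ℝ × ℝ^d)`. -/
def mixedNorm {d : ℕ} (q r : ℝ≥0∞) (F : ℝ → Ed d → ℂ) : ℝ≥0∞ :=
  eLpNorm (fun t => (eLpNorm (F t) r volume).toReal) q volume

/-- Partial derivative `∂_j` of a complex-valued function. -/
def pd {d : ℕ} (j : Fin d) (f : Ed d → ℂ) (x : Ed d) : ℂ :=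
  fderiv ℝ f x (EuclideanSpace.single j 1)

/-- Partial derivative `∂_j` of a real-valued function. -/
def pdR {d : ℕ} (j : Fin d) (f : Ed d → ℝ) (x : Ed d) : ℝ :=
  fderiv ℝ f x (EuclideanSpace.single j 1)

/-- Laplacian of a real-valued function. -/
def lapR {d : ℕ} (f : Ed d → ℝ) : Ed d → ℝ :=
  fun x => ∑ j : Fin d, pdR j (pdR j f) x

/-- Rescaling `χ_R(x) = χ(x/R)`. -/
def chiR {d : ℕ} (χ : Ed d → ℝ) (R : ℝ) : Ed d → ℝ :=
  fun x => χ (R⁻¹ • x)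

/-- Squared `H^{1/2}` norm `(2π)^{-d} ∫ (1+|ξ|²)^{1/2} |𝓕u(ξ)|² dξ`. -/
def H12sq {d : ℕ} (f : Ed d → ℂ) : ℝ :=
  (2 * Real.pi) ^ (-(d : ℝ)) * ∫ ξ : Ed d, (1 + ‖ξ‖ ^ 2) ^ ((1 : ℝ)/2) * ‖FT f ξ‖ ^ 2

theorem integral_rpowIntegrand₀₁_one {s : ℝ} (hs0 : 0 < s) (hs1 : s < 1) :
    ∫ t in Set.Ioi (0 : ℝ), Real.rpowIntegrand₀₁ s t 1 = Real.pi / Real.sin (Real.pi * s) := by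
  have hs : s ∈ Set.Ioo (0 : ℝ) 1 := ⟨hs0, hs1⟩
  have himg : (fun t : ℝ => t / (1 - t)) '' Set.Ioo 0 1 = Set.Ioi 0 := by
    ext y
    constructor
    · rintro ⟨t, ⟨h0, h1⟩, rfl⟩
      exact div_pos h0 (by linarith)
    · intro hy
      have hy : 0 < y := hy
      have hy1 : (1 + y) ≠ 0 := by positivity
      refine ⟨y / (1 + y), ⟨by positivity, by rw [div_lt_one (by positivity)]; linarith⟩, ?_⟩
      field_simp
      ring
  have hinj : Set.InjOn (fun t : ℝ => t / (1 - t)) (Set.Ioo 0 1) := by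
    intro a ha b hb hab
    have h1 : 1 - a ≠ 0 := by linarith [ha.2]
    have h2 : 1 - b ≠ 0 := by linarith [hb.2]
    field_simp at hab
    linarith
  have hder : ∀ t ∈ Set.Ioo (0 : ℝ) 1,
      HasDerivWithinAt (fun t : ℝ => t / (1 - t)) (((1 - t) ^ 2)⁻¹) (Set.Ioo 0 1) t := by
    intro t ht
    have h1 : 1 - t ≠ 0 := by linarith [ht.2]
    have := ((hasDerivAt_id t).div ((hasDerivAt_const t (1 : ℝ)).sub (hasDerivAt_id t)) h1)
    refine (this.congr_deriv ?_).hasDerivWithinAt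
    simp
  rw [← himg, integral_image_eq_integral_abs_deriv_smul measurableSet_Ioo hder hinj]
  have hbeta : ((∫ t in Set.Ioo (0 : ℝ) 1, t ^ (s - 1) * (1 - t) ^ ((1 - s) - 1) : ℝ) : ℂ)
      = Complex.betaIntegral s ((1 - s : ℝ) : ℂ) := by
    rw [Complex.betaIntegral, intervalIntegral.integral_of_le zero_le_one,
      integral_Ioc_eq_integral_Ioo, ← integral_complex_ofReal]
    refine setIntegral_congr_fun measurableSet_Ioo fun t ht => ?_
    rw [Complex.ofReal_mul, Complex.ofReal_cpow ht.1.le,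
      Complex.ofReal_cpow (by linarith [ht.2])]
    push_cast
    rfl
  rw [Complex.betaIntegral_eq_Gamma_mul_div _ _ (by simpa) (by simpa using hs1),
    show (s : ℂ) + ((1 - s : ℝ) : ℂ) = 1 by push_cast; ring, Complex.Gamma_one, div_one,
    Complex.Gamma_ofReal, Complex.Gamma_ofReal, ← Complex.ofReal_mul, Complex.ofReal_inj,
    Real.Gamma_mul_Gamma_one_sub] at hbeta
  rw [← hbeta]
  refine setIntegral_congr_fun measurableSet_Ioo fun t ht => ?_
  have h1 : 0 < 1 - t := by linarith [ht.2]
  simp only [smul_eq_mul]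
  rw [Real.rpowIntegrand₀₁_eq_pow_div hs (div_nonneg ht.1.le h1.le) zero_le_one,
    abs_of_pos (by positivity), Real.div_rpow ht.1.le h1.le,
    show (1 - s) - 1 = -s by ring, Real.rpow_sub_one h1.ne' s, Real.rpow_neg h1.le]
  have : 0 < (1 - t) ^ s := Real.rpow_pos_of_pos h1 _
  field_simp
  ring_nf

theorem integral_rpow_mul_div_add {s a : ℝ} (hs0 : 0 < s) (hs1 : s < 1) (ha : 0 ≤ a) :
    IntegrableOn (fun t : ℝ => t ^ (s - 1) * (a / (a + t))) (Set.Ioi 0) ∧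
      ∫ t in Set.Ioi (0 : ℝ), t ^ (s - 1) * (a / (a + t)) =
        Real.pi / Real.sin (Real.pi * s) * a ^ s := by
  have hs : s ∈ Set.Ioo (0 : ℝ) 1 := ⟨hs0, hs1⟩
  have heq : Set.EqOn (fun t : ℝ => Real.rpowIntegrand₀₁ s t a)
      (fun t => t ^ (s - 1) * (a / (a + t))) (Set.Ioi 0) := fun t ht => by
    simp only
    rw [Real.rpowIntegrand₀₁_eq_pow_div hs (le_of_lt ht) ha, add_comm t a, mul_div_assoc]
  refine ⟨(integrableOn_congr_fun heq measurableSet_Ioi).1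
    (Real.integrableOn_rpowIntegrand₀₁_Ioi hs ha), ?_⟩
  rw [← setIntegral_congr_fun measurableSet_Ioi heq,
    Real.integral_rpowIntegrand₀₁_eq_rpow_mul_const hs ha, integral_rpowIntegrand₀₁_one hs0 hs1,
    mul_comm]

section Calculus

open scoped LineDeriv SchwartzMap ContDiff

variable {d : ℕ}

/-- All iterated derivatives of order between `a` and `b` are bounded. -/
def BoundedDerivs (a b : ℕ) (ψ : Ed d → ℝ) : Prop :=
  ContDiff ℝ ∞ ψ ∧ ∀ n, a ≤ n → n ≤ b → ∃ M : ℝ, ∀ x, ‖iteratedFDeriv ℝ n ψ x‖ ≤ M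

theorem BoundedDerivs.mono {a b a' b' : ℕ} {ψ : Ed d → ℝ} (h : BoundedDerivs a b ψ)
    (ha : a ≤ a') (hb : b' ≤ b) : BoundedDerivs a' b' ψ :=
  ⟨h.1, fun n h1 h2 => h.2 n (ha.trans h1) (h2.trans hb)⟩

theorem BoundedDerivs.pdR {a b : ℕ} {ψ : Ed d → ℝ} (h : BoundedDerivs (a + 1) (b + 1) ψ)
    (j : Fin d) : BoundedDerivs a b (pdR j ψ) := by
  have hf : ContDiff ℝ ∞ (fderiv ℝ ψ) := h.1.fderiv_right (by simp)
  let L : (Ed d →L[ℝ] ℝ) →L[ℝ] ℝ := ContinuousLinearMap.apply ℝ ℝ (EuclideanSpace.single j 1)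
  have hL : _root_.pdR j ψ = L ∘ fderiv ℝ ψ := rfl
  refine ⟨hL ▸ L.contDiff.comp hf, fun n h1 h2 => ?_⟩
  obtain ⟨M, hM⟩ := h.2 (n + 1) (by omega) (by omega)
  refine ⟨‖L‖ * M, fun x => ?_⟩
  rw [hL, L.iteratedFDeriv_comp_left hf.contDiffAt (i := n) (mod_cast le_top)]
  refine (L.norm_compContinuousMultilinearMap_le _).trans ?_
  rw [norm_iteratedFDeriv_fderiv]
  gcongr
  exact hM x

theorem BoundedDerivs.exists_bound {b : ℕ} {ψ : Ed d → ℝ} (h : BoundedDerivs 0 b ψ) :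
    ∃ M : ℝ, ∀ x, ‖ψ x‖ ≤ M := by
  obtain ⟨M, hM⟩ := h.2 0 le_rfl (Nat.zero_le _)
  exact ⟨M, fun x => by simpa using hM x⟩

theorem BoundedDerivs.integrable_mul {b : ℕ} {ψ : Ed d → ℝ} (h : BoundedDerivs 0 b ψ)
    {f : Ed d → ℂ} (hf : Integrable f) : Integrable fun x => (ψ x : ℂ) * f x := by
  obtain ⟨M, hM⟩ := h.exists_bound
  refine hf.bdd_mul (c := M) ?_ (.of_forall fun x => by simpa using hM x)
  exact (Complex.continuous_ofReal.comp h.1.continuous).aestronglyMeasurable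

theorem fderiv_fderiv_apply_comm {F : Type*} [NormedAddCommGroup F] [NormedSpace ℝ F]
    {f : Ed d → F} (hf : ContDiff ℝ ∞ f) (a b x : Ed d) :
    fderiv ℝ (fun y => fderiv ℝ f y a) x b = fderiv ℝ (fun y => fderiv ℝ f y b) x a := by
  have hd : DifferentiableAt ℝ (fderiv ℝ f) x :=
    (hf.fderiv_right (m := ∞) (by simp)).differentiable (by simp) x
  have hsymm : IsSymmSndFDerivAt ℝ f x :=
    (contDiff_infty.1 hf 2).contDiffAt.isSymmSndFDerivAt (by simp)
  rw [fderiv_clm_apply hd (differentiableAt_const a),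
    fderiv_clm_apply hd (differentiableAt_const b)]
  simpa using hsymm b a

theorem pdR_pdR_comm {φ : Ed d → ℝ} (hφ : ContDiff ℝ ∞ φ) (j k : Fin d) (x : Ed d) :
    pdR j (pdR k φ) x = pdR k (pdR j φ) x :=
  fderiv_fderiv_apply_comm hφ _ _ x

theorem integral_pdR_mul {ψ : Ed d → ℝ} (h : BoundedDerivs 0 1 ψ) (j : Fin d)
    (f : 𝓢(Ed d, ℂ)) :
    ∫ x, ((pdR j ψ x : ℝ) : ℂ) * f x =
      -∫ x, (ψ x : ℂ) * (∂_{EuclideanSpace.single j (1 : ℝ)} f : 𝓢(Ed d, ℂ)) x := by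
  have hdψ : Differentiable ℝ ψ := h.1.differentiable (by simp)
  have hderiv : ∀ x v, fderiv ℝ (fun y => (ψ y : ℂ)) x v = ((fderiv ℝ ψ x v : ℝ) : ℂ) := by
    intro x v
    have := (Complex.ofRealCLM.hasFDerivAt.comp x (hdψ x).hasFDerivAt).fderiv
    change fderiv ℝ (fun y => (ψ y : ℂ)) x = _ at this
    rw [this]
    simp
  have key := integral_mul_fderiv_eq_neg_fderiv_mul_of_integrable (μ := volume)
    (f := fun y : Ed d => (ψ y : ℂ)) (g := f) (v := EuclideanSpace.single j (1 : ℝ))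
    (by
      simp_rw [hderiv]
      exact (h.mono (by simp) le_rfl |>.pdR (a := 0) (b := 0) j).integrable_mul f.integrable)
    (h.integrable_mul (∂_{EuclideanSpace.single j (1 : ℝ)} f : 𝓢(Ed d, ℂ)).integrable)
    (h.integrable_mul f.integrable)
    (fun x _ => (Complex.ofRealCLM.differentiableAt.comp x (hdψ x)))
    (fun x _ => f.differentiableAt)
  simp_rw [hderiv] at key
  simp_rw [SchwartzMap.lineDerivOp_apply_eq_fderiv, key, neg_neg]
  rfl

/-- Pointwise product of Schwartz functions. -/
def mulS (f g : 𝓢(Ed d, ℂ)) : 𝓢(Ed d, ℂ) :=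
  SchwartzMap.pairing (ContinuousLinearMap.mul ℝ ℂ) f g

/-- Pointwise complex conjugate of a Schwartz function. -/
def conjS (f : 𝓢(Ed d, ℂ)) : 𝓢(Ed d, ℂ) :=
  f.postcompCLM (Complex.conjCLE : ℂ →L[ℝ] ℂ)

theorem mulS_apply (f g : 𝓢(Ed d, ℂ)) (x : Ed d) : mulS f g x = f x * g x := rfl

theorem conjS_apply (f : 𝓢(Ed d, ℂ)) (x : Ed d) : conjS f x = (starRingEnd ℂ) (f x) := rfl

theorem lineDerivOp_mulS (m : Ed d) (f g : 𝓢(Ed d, ℂ)) :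
    (∂_{m} (mulS f g) : 𝓢(Ed d, ℂ)) = mulS (∂_{m} f) g + mulS f (∂_{m} g) := by
  ext x
  have : (mulS f g : Ed d → ℂ) = fun y => f y * g y := rfl
  simp only [SchwartzMap.lineDerivOp_apply_eq_fderiv, add_apply, mulS_apply]
  rw [this, fderiv_fun_mul f.differentiableAt g.differentiableAt]
  simp
  ring

theorem lineDerivOp_conjS (m : Ed d) (f : 𝓢(Ed d, ℂ)) :
    (∂_{m} (conjS f) : 𝓢(Ed d, ℂ)) = conjS (∂_{m} f) := by
  ext x
  have : (conjS f : Ed d → ℂ) = (Complex.conjCLE : ℂ →L[ℝ] ℂ) ∘ f := rfl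
  simp only [SchwartzMap.lineDerivOp_apply_eq_fderiv, conjS_apply]
  rw [this, fderiv_comp _ (ContinuousLinearMap.differentiableAt _) f.differentiableAt,
    ContinuousLinearMap.fderiv]
  rfl

theorem lineDerivOp_comm (a b : Ed d) (f : 𝓢(Ed d, ℂ)) :
    (∂_{a} (∂_{b} f : 𝓢(Ed d, ℂ)) : 𝓢(Ed d, ℂ)) = ∂_{b} (∂_{a} f : 𝓢(Ed d, ℂ)) := by
  ext x
  exact fderiv_fderiv_apply_comm (f.smooth ⊤) _ _ x

theorem laplacian_apply_eq_sum (v : 𝓢(Ed d, ℂ)) (x : Ed d) :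
    Laplacian.laplacian v x = ∑ j : Fin d,
      (∂_{EuclideanSpace.single j (1 : ℝ)}
        (∂_{EuclideanSpace.single j (1 : ℝ)} v : 𝓢(Ed d, ℂ)) : 𝓢(Ed d, ℂ)) x := by
  rw [SchwartzMap.laplacian_eq_sum (EuclideanSpace.basisFun (Fin d) ℝ)]
  simp

theorem pdR_sum {ι : Type*} (t : Finset ι) (g : ι → Ed d → ℝ)
    (hg : ∀ i, Differentiable ℝ (g i)) (k : Fin d) :
    pdR k (fun x => ∑ i ∈ t, g i x) = fun x => ∑ i ∈ t, pdR k (g i) x := by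
  ext x
  simp only [pdR]
  rw [fderiv_fun_sum fun i _ => hg i x]
  simp

/-- The virial identity for the Laplacian. -/
theorem virial_laplacian {φ : Ed d → ℝ} (h : BoundedDerivs 1 4 φ) (v : 𝓢(Ed d, ℂ)) :
    ∫ x : Ed d,
        (4 * ∑ j : Fin d, ∑ k : Fin d, ((pdR j (pdR k φ) x : ℝ) : ℂ) *
            (starRingEnd ℂ) (pd j v x) * pd k v x
          - ((lapR (lapR φ) x : ℝ) : ℂ) * ((‖v x‖ ^ 2 : ℝ) : ℂ)) =
      ∑ k : Fin d, ∫ x : Ed d, ((pdR k φ x : ℝ) : ℂ) * ((2 *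
        ((starRingEnd ℂ) ((-Laplacian.laplacian v : 𝓢(Ed d, ℂ)) x) * pd k v x -
          (starRingEnd ℂ) (v x) * pd k (-Laplacian.laplacian v : 𝓢(Ed d, ℂ)) x).re : ℝ) : ℂ) := by
  let D : Fin d → 𝓢(Ed d, ℂ) → 𝓢(Ed d, ℂ) := fun j f => ∂_{EuclideanSpace.single j (1 : ℝ)} f
  have hD_mul : ∀ j f g, D j (mulS f g) = mulS (D j f) g + mulS f (D j g) :=
    fun j f g => lineDerivOp_mulS _ f g
  have hD_conj : ∀ j f, D j (conjS f) = conjS (D j f) := fun j f => lineDerivOp_conjS _ f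
  have hD_add : ∀ j f g, D j (f + g) = D j f + D j g :=
    fun j f g => LineDeriv.lineDerivOp_add _ f g
  have hD_comm : ∀ j k f, D j (D k f) = D k (D j f) := fun j k f => lineDerivOp_comm _ _ f
  have hpd : ∀ j (f : 𝓢(Ed d, ℂ)) x, pd j f x = D j f x := fun j f x => rfl
  have hlap : ∀ x, (-Laplacian.laplacian v : 𝓢(Ed d, ℂ)) x = -∑ j, D j (D j v) x := fun x => by
    rw [neg_apply, laplacian_apply_eq_sum]
  have hlap' : ∀ k x, D k (-Laplacian.laplacian v) x = -∑ j, D k (D j (D j v)) x := fun k x => by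
    have : -Laplacian.laplacian v = -∑ j, D j (D j v) := by
      ext x
      rw [hlap, neg_apply, sum_apply]
    rw [this]
    simp only [D]
    rw [LineDeriv.lineDerivOp_neg, LineDeriv.lineDerivOp_sum, neg_apply, sum_apply]
  have h1 : ∀ k, BoundedDerivs 0 3 (pdR k φ) := fun k => h.pdR k
  have h2 : ∀ j k, BoundedDerivs 0 2 (pdR j (pdR k φ)) := fun j k =>
    ((h1 k).mono (by simp) le_rfl).pdR j
  have h3 : ∀ i j k, BoundedDerivs 0 1 (pdR i (pdR j (pdR k φ))) :=
    fun i j k => ((h2 j k).mono (by simp) le_rfl).pdR i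
  have h4 : ∀ l i j k, BoundedDerivs 0 0 (pdR l (pdR i (pdR j (pdR k φ)))) :=
    fun l i j k => ((h3 i j k).mono (by simp) le_rfl).pdR l
  have hbilap : ∀ x, lapR (lapR φ) x = ∑ j, ∑ k, pdR k (pdR k (pdR j (pdR j φ))) x := by
    intro x
    have e1 : ∀ k, pdR k (lapR φ) = fun x => ∑ j, pdR k (pdR j (pdR j φ)) x := fun k =>
      pdR_sum _ _ (fun j => (h2 j j).1.differentiable (by simp)) k
    have e2 : ∀ k, pdR k (pdR k (lapR φ)) = fun x => ∑ j, pdR k (pdR k (pdR j (pdR j φ))) x :=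
      fun k => by
        rw [e1]
        exact pdR_sum _ _ (fun j => (h3 k j j).1.differentiable (by simp)) k
    rw [Finset.sum_comm]
    simp only [lapR] at e2 ⊢
    simp_rw [e2]
  let S : Fin d → Fin d → 𝓢(Ed d, ℂ) := fun j k =>
    mulS (conjS (D j v)) (D k v) + mulS (conjS (D k v)) (D j v)
  let P : 𝓢(Ed d, ℂ) := mulS (conjS v) v
  have hint1 : ∀ j k, Integrable fun x => ((pdR j (pdR k φ) x : ℝ) : ℂ) * S j k x :=
    fun j k => (h2 j k).integrable_mul (S j k).integrable
  have hint2 : ∀ j k, Integrable fun x =>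
      ((pdR k (pdR k (pdR j (pdR j φ))) x : ℝ) : ℂ) * P x :=
    fun j k => (h4 k k j j).integrable_mul P.integrable
  have hint12 : ∀ j k, Integrable fun x => 2 * (((pdR j (pdR k φ) x : ℝ) : ℂ) * S j k x) -
      ((pdR k (pdR k (pdR j (pdR j φ))) x : ℝ) : ℂ) * P x :=
    fun j k => ((hint1 j k).const_mul 2).sub (hint2 j k)
  have hint3 : ∀ k (f : 𝓢(Ed d, ℂ)), Integrable fun x => ((pdR k φ x : ℝ) : ℂ) * f x :=
    fun k f => (h1 k).integrable_mul f.integrable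
  have hpoint : ∀ x, (4 * ∑ j : Fin d, ∑ k : Fin d, ((pdR j (pdR k φ) x : ℝ) : ℂ) *
            (starRingEnd ℂ) (pd j v x) * pd k v x
          - ((lapR (lapR φ) x : ℝ) : ℂ) * ((‖v x‖ ^ 2 : ℝ) : ℂ)) =
      ∑ j, ∑ k, (2 * (((pdR j (pdR k φ) x : ℝ) : ℂ) * S j k x) -
        ((pdR k (pdR k (pdR j (pdR j φ))) x : ℝ) : ℂ) * P x) := by
    intro x
    have hsym : ∑ j : Fin d, ∑ k : Fin d, ((pdR j (pdR k φ) x : ℝ) : ℂ) *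
            (starRingEnd ℂ) (pd j v x) * pd k v x = ∑ j : Fin d, ∑ k : Fin d,
            ((pdR j (pdR k φ) x : ℝ) : ℂ) * ((starRingEnd ℂ) (pd k v x) * pd j v x) := by
      rw [Finset.sum_comm]
      refine Finset.sum_congr rfl fun j _ => Finset.sum_congr rfl fun k _ => ?_
      rw [pdR_pdR_comm h.1, mul_assoc]
    have hnorm : ((‖v x‖ ^ 2 : ℝ) : ℂ) = P x := by
      rw [mulS_apply, conjS_apply, Complex.conj_mul']
      push_cast
      rfl
    rw [show (4 : ℂ) = 2 + 2 by norm_num, add_mul]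
    nth_rewrite 2 [hsym]
    rw [hbilap, hnorm]
    push_cast
    simp only [Finset.sum_sub_distrib, Finset.mul_sum, Finset.sum_mul, ← Finset.sum_add_distrib]
    congr 1
    refine Finset.sum_congr rfl fun j _ => Finset.sum_congr rfl fun k _ => ?_
    simp only [S, add_apply, mulS_apply, conjS_apply, hpd]
    ring
  simp_rw [hpoint]
  rw [integral_finsetSum _ fun j _ => integrable_finsetSum _ fun k _ => hint12 j k]
  have hterm : ∀ j k, ∫ x, (2 * (((pdR j (pdR k φ) x : ℝ) : ℂ) * S j k x) -
        ((pdR k (pdR k (pdR j (pdR j φ))) x : ℝ) : ℂ) * P x) =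
      -2 * (∫ x, ((pdR k φ x : ℝ) : ℂ) * D j (S j k) x) +
        ∫ x, ((pdR j φ x : ℝ) : ℂ) * D j (D k (D k P)) x := by
    intro j k
    rw [integral_sub ((hint1 j k).const_mul 2) (hint2 j k), integral_const_mul,
      integral_pdR_mul ((h1 k).mono le_rfl (by simp)), integral_pdR_mul (h3 k j j),
      integral_pdR_mul ((h2 j j).mono le_rfl (by simp)),
      integral_pdR_mul ((h1 j).mono le_rfl (by simp))]
    simp only [D]
    ring
  have hL : ∑ j, ∫ x, ∑ k, (2 * (((pdR j (pdR k φ) x : ℝ) : ℂ) * S j k x) -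
        ((pdR k (pdR k (pdR j (pdR j φ))) x : ℝ) : ℂ) * P x) =
      ∑ k, ∑ j, ∫ x, ((pdR k φ x : ℝ) : ℂ) * (-2 * D j (S j k) x + D k (D j (D j P)) x) := by
    calc _ = ∑ j, ∑ k, (-2 * (∫ x, ((pdR k φ x : ℝ) : ℂ) * D j (S j k) x) +
        ∫ x, ((pdR j φ x : ℝ) : ℂ) * D j (D k (D k P)) x) := by
          refine Finset.sum_congr rfl fun j _ => ?_
          rw [integral_finsetSum _ fun k _ => hint12 j k]
          exact Finset.sum_congr rfl fun k _ => hterm j k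
      _ = ∑ k, ∑ j, (-2 * (∫ x, ((pdR k φ x : ℝ) : ℂ) * D j (S j k) x) +
        ∫ x, ((pdR k φ x : ℝ) : ℂ) * D k (D j (D j P)) x) := by
          simp only [Finset.sum_add_distrib]
          congr 1
          exact Finset.sum_comm
      _ = _ := by
          refine Finset.sum_congr rfl fun k _ => Finset.sum_congr rfl fun j _ => ?_
          rw [← integral_const_mul, ← integral_add ((hint3 k _).const_mul _) (hint3 k _)]
          congr 1
          ext x
          ring
  rw [hL]
  refine Finset.sum_congr rfl fun k _ => ?_
  have hcomb : ∀ j, Integrable fun x =>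
      ((pdR k φ x : ℝ) : ℂ) * (-2 * D j (S j k) x + D k (D j (D j P)) x) := fun j => by
    refine (((hint3 k (D j (S j k))).const_mul (-2)).add (hint3 k (D k (D j (D j P))))).congr
      (.of_forall fun x => ?_)
    simp only [Pi.add_apply]
    ring
  rw [← integral_finsetSum _ fun j _ => hcomb j]
  congr 1
  ext x
  rw [← Finset.mul_sum]
  congr 1
  rw [hpd, hpd, hlap, hlap']
  rw [← Complex.add_conj]
  simp only [map_sub, map_mul, map_neg, map_sum, Complex.conj_conj, Finset.sum_mul,
    Finset.mul_sum, neg_mul, mul_neg, ← Finset.sum_neg_distrib, ← Finset.sum_sub_distrib,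
    ← Finset.sum_add_distrib]
  refine Finset.sum_congr rfl fun j _ => ?_
  simp only [S, P, hD_add, hD_mul, hD_conj, add_apply, mulS_apply, conjS_apply, hD_comm j k v]
  ring

end Calculus

section Multiplier

open scoped LineDeriv SchwartzMap ContDiff FourierTransform Laplacian

variable {d : ℕ}

/-- The Fourier multiplier with real symbol `m`, where `m` is a function of the frequency variable
in Mathlib's normalization of the Fourier transform. -/
def multiplier (m : Ed d → ℝ) (u : 𝓢(Ed d, ℂ)) : Ed d → ℂ :=
  𝓕⁻ (fun η => (m η : ℂ) * 𝓕 (u : Ed d → ℂ) η)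

theorem FT_two_pi_smul (f : Ed d → ℂ) (η : Ed d) : FT f ((2 * Real.pi) • η) = 𝓕 f η := by
  rw [FT, Real.fourier_eq']
  congr 1
  ext x
  rw [inner_smul_right, smul_eq_mul]
  congr 2
  push_cast
  ring

theorem FTinv_eq_fourierInv (g : Ed d → ℂ) :
    FTinv g = 𝓕⁻ (fun η => g ((2 * Real.pi) • η)) := by
  ext x
  have h := Measure.integral_comp_smul_of_nonneg volume
    (fun ξ : Ed d => Complex.exp (Complex.I * ((⟪x, ξ⟫ : ℝ) : ℂ)) * g ξ) (2 * Real.pi)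
    (hR := by positivity)
  rw [FTinv, Real.fourierInv_eq', Real.rpow_neg (by positivity), Real.rpow_natCast]
  rw [finrank_euclideanSpace_fin, Complex.real_smul] at h
  rw [← h]
  congr 1
  ext η
  rw [inner_smul_right, smul_eq_mul, real_inner_comm]
  congr 2
  push_cast
  ring

theorem fracD_eq_multiplier (s : ℝ) (u : 𝓢(Ed d, ℂ)) :
    fracD (2 * s) u = multiplier (fun η => ((2 * Real.pi * ‖η‖) ^ 2) ^ s) u := by
  rw [fracD, FTinv_eq_fourierInv, multiplier]
  congr 1
  ext η
  rw [FT_two_pi_smul, norm_smul, Real.norm_of_nonneg (by positivity),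
    Real.rpow_mul (by positivity), Real.rpow_two]

theorem resolv_eq_multiplier (lam : ℝ) (u : 𝓢(Ed d, ℂ)) :
    resolv lam u = multiplier (fun η => ((2 * Real.pi * ‖η‖) ^ 2 + lam)⁻¹) u := by
  rw [resolv, FTinv_eq_fourierInv, multiplier]
  congr 1
  ext η
  rw [FT_two_pi_smul, norm_smul, Real.norm_of_nonneg (by positivity), div_eq_inv_mul]
  push_cast
  rfl

theorem multiplier_eq_fourierMultiplierCLM {m : Ed d → ℝ} (hm : m.HasTemperateGrowth)
    (u : 𝓢(Ed d, ℂ)) : multiplier m u = SchwartzMap.fourierMultiplierCLM ℂ m u := by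
  rw [SchwartzMap.fourierMultiplierCLM_apply, SchwartzMap.fourierInv_coe, multiplier]
  congr 1
  ext η
  rw [SchwartzMap.smulLeftCLM_apply_apply hm, Complex.real_smul, SchwartzMap.fourier_coe]

theorem hasTemperateGrowth_inv_symbol {lam : ℝ} (hl : 0 < lam) :
    (fun η : Ed d => ((2 * Real.pi * ‖η‖) ^ 2 + lam)⁻¹).HasTemperateGrowth := by
  have h1 : (fun η : Ed d => (2 * Real.pi / √lam) • η).HasTemperateGrowth :=
    ((2 * Real.pi / √lam) • ContinuousLinearMap.id ℝ (Ed d)).hasTemperateGrowth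
  have h2 := (Function.HasTemperateGrowth.const (E := Ed d) lam⁻¹).mul
    ((Function.hasTemperateGrowth_one_add_norm_sq_rpow (Ed d) (-1)).comp h1)
  convert! h2 using 1
  ext η
  simp only [Pi.mul_apply, Function.comp_apply]
  rw [Real.rpow_neg_one, ← mul_inv, norm_smul, Real.norm_of_nonneg (by positivity), mul_pow (_ / _),
    div_pow, Real.sq_sqrt hl.le]
  congr 1
  field_simp
  ring

theorem hasTemperateGrowth_symbol :
    (fun η : Ed d => (2 * Real.pi * ‖η‖) ^ 2).HasTemperateGrowth := by
  have := (Function.HasTemperateGrowth.const (E := Ed d) ((2 * Real.pi) ^ 2)).mul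
    (Function.hasTemperateGrowth_norm_sq (Ed d))
  convert! this using 1
  ext η
  simp [mul_pow]

theorem neg_laplacian_eq (v : 𝓢(Ed d, ℂ)) :
    -Δ v = SchwartzMap.fourierMultiplierCLM ℂ (fun η : Ed d => (2 * Real.pi * ‖η‖) ^ 2) v := by
  have h : (fun η : Ed d => (2 * Real.pi * ‖η‖) ^ 2) = (2 * Real.pi) ^ 2 • (fun η => ‖η‖ ^ 2) := by
    ext η
    simp [mul_pow]
  rw [SchwartzMap.laplacian_eq_fourierMultiplierCLM, h,
    SchwartzMap.fourierMultiplierCLM_smul (Function.hasTemperateGrowth_norm_sq (Ed d)), smul_apply,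
    neg_smul, neg_neg]

/-- The resolvent of a Schwartz function is a Schwartz function solving the resolvent equation. -/
theorem exists_resolvent {lam : ℝ} (hl : 0 < lam) (u : 𝓢(Ed d, ℂ)) :
    ∃ v : 𝓢(Ed d, ℂ), ⇑v = resolv lam u ∧ u = -Δ v + lam • v ∧
      ⇑(-Δ v) = multiplier
        (fun η => (2 * Real.pi * ‖η‖) ^ 2 / ((2 * Real.pi * ‖η‖) ^ 2 + lam)) u := by
  have hr := hasTemperateGrowth_inv_symbol (d := d) hl
  have ha := hasTemperateGrowth_symbol (d := d)
  have hm : (fun η : Ed d => (2 * Real.pi * ‖η‖) ^ 2 / ((2 * Real.pi * ‖η‖) ^ 2 + lam)) =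
      (fun η => (2 * Real.pi * ‖η‖) ^ 2) * (fun η => ((2 * Real.pi * ‖η‖) ^ 2 + lam)⁻¹) := by
    ext η
    simp [div_eq_mul_inv]
  refine ⟨SchwartzMap.fourierMultiplierCLM ℂ
    (fun η : Ed d => ((2 * Real.pi * ‖η‖) ^ 2 + lam)⁻¹) u, ?_, ?_, ?_⟩
  · rw [resolv_eq_multiplier, multiplier_eq_fourierMultiplierCLM hr]
  · rw [neg_laplacian_eq, SchwartzMap.fourierMultiplierCLM_fourierMultiplierCLM_apply ha hr,
      ← smul_apply, ← SchwartzMap.fourierMultiplierCLM_smul hr,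
      SchwartzMap.fourierMultiplierCLM_apply,
      SchwartzMap.fourierMultiplierCLM_apply, ← FourierTransform.fourierInv_add]
    rw [← FourierTransform.fourierInv_fourier_eq (F := 𝓢(Ed d, ℂ)) u]
    congr 1
    ext η
    rw [FourierTransform.fourierInv_fourier_eq, add_apply,
      SchwartzMap.smulLeftCLM_apply_apply (ha.mul hr),
      SchwartzMap.smulLeftCLM_smul hr, smul_apply, smul_apply, SchwartzMap.smulLeftCLM_apply_apply hr,
      smul_smul,
      ← add_smul]
    have : (2 * Real.pi * ‖η‖) ^ 2 + lam ≠ 0 := by positivity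
    simp only [Pi.mul_apply]
    rw [← add_mul, mul_inv_cancel₀ this, one_smul]
  · rw [neg_laplacian_eq, SchwartzMap.fourierMultiplierCLM_fourierMultiplierCLM_apply ha hr, hm,
      multiplier_eq_fourierMultiplierCLM (ha.mul hr)]

theorem continuous_fourierInv {f : Ed d → ℂ} (hf : Integrable f) : Continuous (𝓕⁻ f) :=
  VectorFourier.fourierIntegral_continuous (L := -innerₗ (Ed d)) Real.continuous_fourierChar
    (continuous_inner.neg) hf

theorem norm_fourierInv_le (f : Ed d → ℂ) (x : Ed d) : ‖𝓕⁻ f x‖ ≤ ∫ y, ‖f y‖ :=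
  VectorFourier.norm_fourierIntegral_le_integral_norm _ _ (-innerₗ (Ed d)) f x

theorem integral_fourierInv_mul {f g : Ed d → ℂ} (hf : Integrable f) (hg : Integrable g) :
    ∫ x, 𝓕⁻ g x * f x = ∫ η, g η * 𝓕⁻ f η := by
  have h := VectorFourier.integral_fourierIntegral_smul_eq_flip (L := -innerₗ (Ed d))
    Real.continuous_fourierChar continuous_inner.neg hg hf
  have hL : (-innerₗ (Ed d)).flip = -innerₗ (Ed d) := by
    ext x y
    simp [real_inner_comm]
  rw [hL] at h
  exact h

theorem integrable_fourierInv_mul {f g : Ed d → ℂ} (hf : Integrable f) (hg : Integrable g) :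
    Integrable fun x => 𝓕⁻ g x * f x :=
  hf.bdd_mul (continuous_fourierInv hg).aestronglyMeasurable
    (.of_forall (norm_fourierInv_le g))

theorem pd_fourierInv {g : Ed d → ℂ} (hg : Integrable g) (hg' : Integrable fun η => ‖η‖ * ‖g η‖)
    (j : Fin d) :
    pd j (𝓕⁻ g) = 𝓕⁻ (fun η => 2 * Real.pi * Complex.I * (η j : ℂ) * g η) := by
  ext x
  have h1 : HasFDerivAt (𝓕⁻ g)
      ((𝓕 (VectorFourier.fourierSMulRight (innerSL ℝ) g) (-x)).comp
        (-ContinuousLinearMap.id ℝ (Ed d))) x := by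
    have h := Real.hasFDerivAt_fourier hg hg' (-x)
    have h2 := h.comp x (hasFDerivAt_id x).neg
    have h3 : 𝓕⁻ g = 𝓕 g ∘ fun x => -x := by
      ext y
      exact Real.fourierInv_eq_fourier_neg g y
    rw [h3]
    exact h2
  have h4 : Integrable (VectorFourier.fourierSMulRight (innerSL ℝ) g) := by
    refine (hg'.const_mul (2 * Real.pi * ‖innerSL ℝ (E := Ed d)‖)).mono'
      hg.1.fourierSMulRight (.of_forall fun η => ?_)
    refine (VectorFourier.norm_fourierSMulRight_le _ _ _).trans (le_of_eq ?_)
    ring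
  rw [pd, h1.fderiv, Real.fourierInv_eq_fourier_neg]
  simp only [ContinuousLinearMap.comp_apply, neg_apply, ContinuousLinearMap.id_apply, map_neg]
  rw [Real.fourier_continuousLinearMap_apply h4, Real.fourier_eq, Real.fourier_eq, ← integral_neg]
  congr 1
  ext η
  rw [← smul_neg]
  congr 1
  rw [VectorFourier.fourierSMulRight_apply, innerSL_apply_apply,
    EuclideanSpace.inner_single_right]
  simp
  ring

/-- The weighted integrability of the Fourier transform of a Schwartz function. -/
theorem integrable_one_add_norm_pow_mul_fourier (u : 𝓢(Ed d, ℂ)) (k : ℕ) :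
    Integrable fun η => (1 + ‖η‖) ^ k * ‖𝓕 (u : Ed d → ℂ) η‖ := by
  have h0 := ((𝓕 u).integrable_pow_mul volume 0).add ((𝓕 u).integrable_pow_mul volume k)
  rw [SchwartzMap.fourier_coe] at h0
  have hc : Continuous (𝓕 (u : Ed d → ℂ)) := by
    rw [← SchwartzMap.fourier_coe]
    exact (𝓕 u).continuous
  refine (h0.const_mul (2 ^ (k - 1))).mono'
    (by fun_prop) (.of_forall fun η => ?_)
  rw [Real.norm_of_nonneg (by positivity)]
  have h := add_pow_le zero_le_one (norm_nonneg η) k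
  rw [one_pow] at h
  calc (1 + ‖η‖) ^ k * ‖𝓕 (u : Ed d → ℂ) η‖
      ≤ 2 ^ (k - 1) * (1 + ‖η‖ ^ k) * ‖𝓕 (u : Ed d → ℂ) η‖ := by gcongr
    _ = _ := by
      simp only [Pi.add_apply, pow_zero]
      ring

/-- The commutator form associated with the vector field `∇φ`. -/
def virialForm (φ : Ed d → ℝ) (u : 𝓢(Ed d, ℂ)) (f : Ed d → ℂ) : ℂ :=
  (∫ x, (starRingEnd ℂ) (f x) * ∑ j, pd j u x * (pdR j φ x : ℂ)) -
    ∫ x, (starRingEnd ℂ) (u x) * ∑ j, pd j f x * (pdR j φ x : ℂ)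

/-- The density representing `m ↦ virialForm φ u (multiplier m u)`. -/
def virialDensity (φ : Ed d → ℝ) (u : 𝓢(Ed d, ℂ)) (η : Ed d) : ℂ :=
  (starRingEnd ℂ) (𝓕 (u : Ed d → ℂ) η *
      𝓕⁻ (fun x => (starRingEnd ℂ) (∑ j, pd j u x * (pdR j φ x : ℂ))) η) -
    ∑ j, 2 * Real.pi * Complex.I * (η j : ℂ) * 𝓕 (u : Ed d → ℂ) η *
      𝓕⁻ (fun x => (starRingEnd ℂ) (u x) * (pdR j φ x : ℂ)) η

theorem integrable_conj_gradient_mul {φ : Ed d → ℝ} (h : BoundedDerivs 1 4 φ) (u : 𝓢(Ed d, ℂ)) :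
    Integrable fun x => (starRingEnd ℂ) (∑ j, pd j u x * (pdR j φ x : ℂ)) := by
  simp only [map_sum]
  refine integrable_finsetSum _ fun j _ => ?_
  refine ((h.pdR (a := 0) j).integrable_mul
    (conjS (∂_{EuclideanSpace.single j (1 : ℝ)} u : 𝓢(Ed d, ℂ))).integrable).congr
    (.of_forall fun x => ?_)
  simp only [conjS_apply, map_mul, Complex.conj_ofReal]
  rw [mul_comm]
  rfl

theorem integrable_conj_mul {φ : Ed d → ℝ} (h : BoundedDerivs 1 4 φ) (u : 𝓢(Ed d, ℂ))
    (j : Fin d) : Integrable fun x => (starRingEnd ℂ) (u x) * (pdR j φ x : ℂ) := by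
  refine ((h.pdR (a := 0) j).integrable_mul (conjS u).integrable).congr (.of_forall fun x => ?_)
  simp only [conjS_apply]
  rw [mul_comm]

theorem continuous_virialDensity {φ : Ed d → ℝ} (h : BoundedDerivs 1 4 φ) (u : 𝓢(Ed d, ℂ)) :
    Continuous (virialDensity φ u) := by
  have hc : Continuous (𝓕 (u : Ed d → ℂ)) := by
    rw [← SchwartzMap.fourier_coe]
    exact (𝓕 u).continuous
  have h1 := continuous_fourierInv (integrable_conj_gradient_mul h u)
  have h2 := fun j => continuous_fourierInv (integrable_conj_mul h u j)
  unfold virialDensity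
  refine (Complex.continuous_conj.comp (hc.mul h1)).sub (continuous_finsetSum _ fun j _ => ?_)
  refine Continuous.mul ?_ (h2 j)
  fun_prop

theorem exists_norm_virialDensity_le (φ : Ed d → ℝ) (u : 𝓢(Ed d, ℂ)) :
    ∃ C : ℝ, ∀ η, ‖virialDensity φ u η‖ ≤ C * ((1 + ‖η‖) * ‖𝓕 (u : Ed d → ℂ) η‖) := by
  obtain ⟨A, hA⟩ : ∃ A, ∀ η,
      ‖𝓕⁻ (fun x => (starRingEnd ℂ) (∑ j, pd j u x * (pdR j φ x : ℂ))) η‖ ≤ A :=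
    ⟨_, norm_fourierInv_le _⟩
  have hB : ∀ j, ∃ B, ∀ η, ‖𝓕⁻ (fun x => (starRingEnd ℂ) (u x) * (pdR j φ x : ℂ)) η‖ ≤ B :=
    fun j => ⟨_, norm_fourierInv_le _⟩
  choose B hB using hB
  have hA0 : 0 ≤ A := (norm_nonneg _).trans (hA 0)
  have hB0 : ∀ j, 0 ≤ B j := fun j => (norm_nonneg _).trans (hB j 0)
  refine ⟨A + ∑ j, 2 * Real.pi * B j, fun η => ?_⟩
  set U := ‖𝓕 (u : Ed d → ℂ) η‖ with hU
  have hU0 : 0 ≤ U := norm_nonneg _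
  have hη := norm_nonneg η
  rw [virialDensity, add_mul, Finset.sum_mul]
  refine (norm_sub_le _ _).trans (add_le_add ?_ ((norm_sum_le _ _).trans
    (Finset.sum_le_sum fun j _ => ?_)))
  · rw [RCLike.norm_conj, norm_mul]
    calc U * _ ≤ U * A := by gcongr; exact hA η
      _ ≤ A * ((1 + ‖η‖) * U) := by nlinarith [mul_nonneg (mul_nonneg hA0 hη) hU0]
  · have hj : ‖(η j : ℂ)‖ ≤ ‖η‖ := by
      simpa using PiLp.norm_apply_le η j
    simp only [norm_mul, Complex.norm_I, Complex.norm_ofNat, mul_one]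
    rw [Complex.norm_of_nonneg Real.pi_pos.le, ← hU]
    calc 2 * Real.pi * ‖(η j : ℂ)‖ * U * _ ≤ 2 * Real.pi * (1 + ‖η‖) * U * B j := by
          gcongr
          · linarith
          · exact hB j η
      _ = _ := by ring

/-- Plancherel representation of the commutator form on Fourier multipliers. -/
theorem virialForm_multiplier {φ : Ed d → ℝ} (h : BoundedDerivs 1 4 φ) (u : 𝓢(Ed d, ℂ))
    {m : Ed d → ℝ} (hm : Measurable m) {C : ℝ} (hC : ∀ η, |m η| ≤ C * (1 + ‖η‖) ^ 2) :
    virialForm φ u (multiplier m u) = ∫ η, (m η : ℂ) * virialDensity φ u η := by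
  have hc : Continuous (𝓕 (u : Ed d → ℂ)) := by
    rw [← SchwartzMap.fourier_coe]
    exact (𝓕 u).continuous
  have hC0 : 0 ≤ C := by simpa using (abs_nonneg _).trans (hC 0)
  set g : Ed d → ℂ := fun η => (m η : ℂ) * 𝓕 (u : Ed d → ℂ) η with hgdef
  have hgm : AEStronglyMeasurable g volume :=
    ((Complex.measurable_ofReal.comp hm).mul hc.measurable).aestronglyMeasurable
  have hgle : ∀ η, ‖g η‖ ≤ C * ((1 + ‖η‖) ^ 2 * ‖𝓕 (u : Ed d → ℂ) η‖) := fun η => by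
    rw [hgdef, norm_mul, Complex.norm_real, Real.norm_eq_abs, ← mul_assoc]
    gcongr
    exact hC η
  have hg : Integrable g :=
    ((integrable_one_add_norm_pow_mul_fourier u 2).const_mul C).mono' hgm (.of_forall hgle)
  have hg' : Integrable fun η => ‖η‖ * ‖g η‖ := by
    refine ((integrable_one_add_norm_pow_mul_fourier u 3).const_mul C).mono'
      (continuous_norm.aestronglyMeasurable.mul hgm.norm) (.of_forall fun η => ?_)
    rw [Real.norm_of_nonneg (by positivity)]
    calc ‖η‖ * ‖g η‖ ≤ (1 + ‖η‖) * (C * ((1 + ‖η‖) ^ 2 * ‖𝓕 (u : Ed d → ℂ) η‖)) := by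
          gcongr
          · linarith
          · exact hgle η
      _ = _ := by ring
  have hgj : ∀ j : Fin d, Integrable fun η : Ed d => 2 * Real.pi * Complex.I * (η j : ℂ) * g η :=
    fun j => by
    refine (hg'.const_mul (2 * Real.pi)).mono' (AEStronglyMeasurable.mul
      (by fun_prop) hgm) (.of_forall fun η => ?_)
    have hj : ‖(η j : ℂ)‖ ≤ ‖η‖ := by
      simpa using PiLp.norm_apply_le η j
    simp only [norm_mul, Complex.norm_I, Complex.norm_ofNat, mul_one]
    rw [Complex.norm_of_nonneg Real.pi_pos.le, mul_assoc]
    gcongr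
  have hX := integrable_conj_gradient_mul h u
  have hY := integrable_conj_mul h u
  have e1 : ∫ x, (starRingEnd ℂ) (multiplier m u x) * ∑ j, pd j u x * (pdR j φ x : ℂ) =
      ∫ η, (m η : ℂ) * (starRingEnd ℂ) (𝓕 (u : Ed d → ℂ) η *
      𝓕⁻ (fun x => (starRingEnd ℂ) (∑ j, pd j u x * (pdR j φ x : ℂ))) η) := by
    have := congrArg (starRingEnd ℂ) (integral_fourierInv_mul hX hg)
    rw [← integral_conj, ← integral_conj] at this
    simp only [map_mul, Complex.conj_conj, hgdef, Complex.conj_ofReal] at this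
    simp only [map_mul, ← mul_assoc]
    exact this
  have hint : ∀ j, Integrable fun η : Ed d => (2 * Real.pi * Complex.I * (η j : ℂ) * g η) *
      𝓕⁻ (fun x => (starRingEnd ℂ) (u x) * (pdR j φ x : ℂ)) η := fun j =>
    (integrable_fourierInv_mul (hgj j) (hY j)).congr (.of_forall fun η => mul_comm _ _)
  have e2 : ∫ x, (starRingEnd ℂ) (u x) * ∑ j, pd j (multiplier m u) x * (pdR j φ x : ℂ) =
      ∫ η, ∑ j, (2 * Real.pi * Complex.I * (η j : ℂ) * g η) *
        𝓕⁻ (fun x => (starRingEnd ℂ) (u x) * (pdR j φ x : ℂ)) η := by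
    rw [integral_finsetSum _ fun j _ => hint j]
    simp_rw [← fun j => integral_fourierInv_mul (hY j) (hgj j)]
    rw [← integral_finsetSum _ fun j _ => integrable_fourierInv_mul (hY j) (hgj j)]
    congr 1
    ext x
    rw [Finset.mul_sum]
    refine Finset.sum_congr rfl fun j _ => ?_
    rw [← pd_fourierInv hg hg' j]
    change _ * (pd j (multiplier m u) x * _) = pd j (multiplier m u) x * _
    ring
  have i1 : Integrable fun η => (m η : ℂ) * (starRingEnd ℂ) (𝓕 (u : Ed d → ℂ) η *
      𝓕⁻ (fun x => (starRingEnd ℂ) (∑ j, pd j u x * (pdR j φ x : ℂ))) η) := by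
    have h1 := (integrable_fourierInv_mul hg hX)
    have h2 := h1.norm.mono' (f := fun η => (starRingEnd ℂ) (𝓕⁻ (fun x => (starRingEnd ℂ)
      (∑ j, pd j u x * (pdR j φ x : ℂ))) η * g η))
      (Complex.continuous_conj.comp_aestronglyMeasurable h1.1)
      (.of_forall fun η => (RCLike.norm_conj _).le)
    refine h2.congr (.of_forall fun η => ?_)
    simp only [hgdef, map_mul, Complex.conj_ofReal]
    ring
  rw [virialForm, e1, e2, ← integral_sub i1 (integrable_finsetSum _ fun j _ => hint j)]
  congr 1
  ext η
  rw [virialDensity, mul_sub, Finset.mul_sum]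
  congr 1
  refine Finset.sum_congr rfl fun j _ => ?_
  simp only [hgdef]
  ring

theorem symbol_rpow_le {s : ℝ} (hs0 : 0 < s) (hs1 : s < 1) (η : Ed d) :
    ((2 * Real.pi * ‖η‖) ^ 2) ^ s ≤ (1 + (2 * Real.pi) ^ 2) * (1 + ‖η‖) ^ 2 := by
  have h1 : ((2 * Real.pi * ‖η‖) ^ 2) ^ s ≤ 1 + (2 * Real.pi * ‖η‖) ^ 2 := by
    rcases le_total ((2 * Real.pi * ‖η‖) ^ 2) 1 with h | h
    · exact (Real.rpow_le_one (by positivity) h hs0.le).trans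
        (by linarith [sq_nonneg (2 * Real.pi * ‖η‖)])
    · refine (Real.rpow_le_rpow_of_exponent_le h hs1.le).trans ?_
      rw [Real.rpow_one]
      linarith
  refine h1.trans ?_
  have := norm_nonneg η
  have h2 : ‖η‖ ^ 2 ≤ (1 + ‖η‖) ^ 2 := by nlinarith
  have h3 : 1 ≤ (1 + ‖η‖) ^ 2 := by nlinarith
  rw [mul_pow, add_mul, one_mul]
  gcongr

/-- The fractional power of the Laplacian as a superposition of resolvents, tested against the
commutator form. -/
theorem integral_virialForm_resolvent {s : ℝ} (hs0 : 0 < s) (hs1 : s < 1) {φ : Ed d → ℝ}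
    (h : BoundedDerivs 1 4 φ) (u : 𝓢(Ed d, ℂ)) :
    IntegrableOn (fun lam : ℝ => ((lam ^ (s - 1) : ℝ) : ℂ) * virialForm φ u (multiplier (fun η =>
        (2 * Real.pi * ‖η‖) ^ 2 / ((2 * Real.pi * ‖η‖) ^ 2 + lam)) u)) (Set.Ioi 0) ∧
      ∫ lam in Set.Ioi (0 : ℝ), ((lam ^ (s - 1) : ℝ) : ℂ) * virialForm φ u (multiplier (fun η =>
        (2 * Real.pi * ‖η‖) ^ 2 / ((2 * Real.pi * ‖η‖) ^ 2 + lam)) u) =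
      ((Real.pi / Real.sin (Real.pi * s) : ℝ) : ℂ) * virialForm φ u (fracD (2 * s) u) := by
  set a : Ed d → ℝ := fun η => (2 * Real.pi * ‖η‖) ^ 2 with ha
  have ha0 : ∀ η, 0 ≤ a η := fun η => by positivity
  have ham : Measurable a := by fun_prop
  set B := virialDensity φ u with hB
  have hBc : Continuous B := continuous_virialDensity h u
  set F : ℝ × Ed d → ℂ := fun p =>
    ((p.1 ^ (s - 1) * (a p.2 / (a p.2 + p.1)) : ℝ) : ℂ) * B p.2 with hF
  have hFm : AEStronglyMeasurable F ((volume.restrict (Set.Ioi 0)).prod volume) := by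
    refine Measurable.aestronglyMeasurable ?_
    have hB2 : Measurable fun p : ℝ × Ed d => B p.2 := hBc.measurable.comp measurable_snd
    have ha2 : Measurable fun p : ℝ × Ed d => a p.2 := ham.comp measurable_snd
    fun_prop
  have hnorm : ∀ η, ∫ lam in Set.Ioi (0 : ℝ), ‖F (lam, η)‖ =
      Real.pi / Real.sin (Real.pi * s) * a η ^ s * ‖B η‖ := fun η => by
    rw [← (integral_rpow_mul_div_add hs0 hs1 (ha0 η)).2, ← integral_mul_const]
    refine setIntegral_congr_fun measurableSet_Ioi fun lam (hl : 0 < lam) => ?_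
    simp only [hF]
    have := ha0 η
    rw [norm_mul, Complex.norm_of_nonneg (by positivity)]
  have hFi : Integrable F ((volume.restrict (Set.Ioi 0)).prod volume) := by
    refine (integrable_prod_iff' hFm).2 ⟨.of_forall fun η => ?_, ?_⟩
    · exact ((integral_rpow_mul_div_add hs0 hs1 (ha0 η)).1.ofReal).mul_const (B η)
    · simp_rw [hnorm]
      obtain ⟨C, hC⟩ := exists_norm_virialDensity_le φ u
      refine (((integrable_one_add_norm_pow_mul_fourier u 3).const_mul
        (|Real.pi / Real.sin (Real.pi * s)| * (1 + (2 * Real.pi) ^ 2) * C))).mono'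
        (((ham.pow_const s).const_mul _).mul hBc.norm.measurable).aestronglyMeasurable
        (.of_forall fun η => ?_)
      have h0 : 0 ≤ a η ^ s := Real.rpow_nonneg (ha0 η) s
      rw [norm_mul, norm_mul, norm_norm, Real.norm_eq_abs, Real.norm_of_nonneg h0]
      calc |Real.pi / Real.sin (Real.pi * s)| * a η ^ s * ‖B η‖
          ≤ |Real.pi / Real.sin (Real.pi * s)| * ((1 + (2 * Real.pi) ^ 2) * (1 + ‖η‖) ^ 2) *
            (C * ((1 + ‖η‖) * ‖𝓕 (u : Ed d → ℂ) η‖)) := by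
            gcongr
            · exact symbol_rpow_le hs0 hs1 η
            · exact hC η
        _ = _ := by ring
  have hform : ∀ lam ∈ Set.Ioi (0 : ℝ), ((lam ^ (s - 1) : ℝ) : ℂ) * virialForm φ u
      (multiplier (fun η => a η / (a η + lam)) u) = ∫ η, F (lam, η) := fun lam hl => by
    have hl : 0 < lam := hl
    rw [virialForm_multiplier h u (C := 1) (by fun_prop), ← integral_const_mul]
    · simp only [hF]
      congr 1
      ext η
      push_cast
      ring
    · intro η
      have := ha0 η
      rw [abs_of_nonneg (by positivity), one_mul, div_le_iff₀ (by positivity)]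
      have h1 : 1 ≤ (1 + ‖η‖) ^ 2 := by nlinarith [norm_nonneg η]
      nlinarith
  refine ⟨hFi.integral_prod_left.congr ?_, ?_⟩
  · exact (ae_restrict_iff' measurableSet_Ioi).2 (.of_forall fun lam hl => (hform lam hl).symm)
  · rw [setIntegral_congr_fun measurableSet_Ioi hform,
      integral_integral_swap (f := fun x y => F (x, y)) hFi,
      fracD_eq_multiplier, virialForm_multiplier h u (C := 1 + (2 * Real.pi) ^ 2) (by fun_prop),
      ← integral_const_mul]
    · congr 1
      ext η
      simp only [hF]
      rw [integral_mul_const, integral_complex_ofReal,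
        (integral_rpow_mul_div_add hs0 hs1 (ha0 η)).2]
      push_cast
      ring
    · intro η
      rw [abs_of_nonneg (by positivity)]
      exact symbol_rpow_le hs0 hs1 η

theorem integrable_pdR_mul_conj_mul_pd {φ : Ed d → ℝ} (h : BoundedDerivs 1 4 φ)
    (f g : 𝓢(Ed d, ℂ)) (k : Fin d) :
    Integrable fun x => (pdR k φ x : ℂ) * ((starRingEnd ℂ) (f x) * pd k g x) :=
  ((h.pdR (a := 0) k).integrable_mul
    (mulS (conjS f) (∂_{EuclideanSpace.single k (1 : ℝ)} g : 𝓢(Ed d, ℂ))).integrable).congr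
    (.of_forall fun x => by simp only [mulS_apply, conjS_apply]; rfl)

theorem virialForm_schwartz {φ : Ed d → ℝ} (h : BoundedDerivs 1 4 φ) (u w : 𝓢(Ed d, ℂ)) :
    virialForm φ u w = ∑ k, ∫ x, (pdR k φ x : ℂ) *
      ((starRingEnd ℂ) (w x) * pd k u x - (starRingEnd ℂ) (u x) * pd k w x) := by
  have hint := integrable_pdR_mul_conj_mul_pd h
  have hsum : ∀ f g : 𝓢(Ed d, ℂ), ∫ x, (starRingEnd ℂ) (f x) * ∑ j, pd j g x * (pdR j φ x : ℂ) =
      ∑ k, ∫ x, (pdR k φ x : ℂ) * ((starRingEnd ℂ) (f x) * pd k g x) := fun f g => by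
    rw [← integral_finsetSum _ fun k _ => hint f g k]
    congr 1
    ext x
    rw [Finset.mul_sum]
    exact Finset.sum_congr rfl fun k _ => by ring
  rw [virialForm, hsum, hsum, ← Finset.sum_sub_distrib]
  refine Finset.sum_congr rfl fun k _ => ?_
  simp_rw [mul_sub]
  rw [integral_sub (hint w u k) (hint u w k)]

theorem pd_const_mul (c : ℂ) (j : Fin d) (v : 𝓢(Ed d, ℂ)) (x : Ed d) :
    pd j (fun y => c * v y) x = c * pd j v x := by
  rw [pd, fderiv_const_mul v.differentiableAt]
  rfl

/-- The virial integrand of the resolvent regularization in terms of the commutator form. -/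
theorem integral_virial_reg {s lam : ℝ} (hs0 : 0 < s) (hs1 : s < 1) (hl : 0 < lam) {φ : Ed d → ℝ}
    (h : BoundedDerivs 1 4 φ) (u : 𝓢(Ed d, ℂ)) :
    (lam : ℂ) * ∫ x : Ed d, (4 * ∑ j : Fin d, ∑ k : Fin d, ((pdR j (pdR k φ) x : ℝ) : ℂ) *
        (starRingEnd ℂ) (pd j (reg s lam u) x) * pd k (reg s lam u) x
        - ((lapR (lapR φ) x : ℝ) : ℂ) * ((‖reg s lam u x‖ ^ 2 : ℝ) : ℂ)) =
      ((Real.sin (Real.pi * s) / Real.pi * (2 * (virialForm φ u (multiplier (fun η =>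
        (2 * Real.pi * ‖η‖) ^ 2 / ((2 * Real.pi * ‖η‖) ^ 2 + lam)) u)).re) : ℝ) : ℂ) := by
  obtain ⟨v, hv, huv, hw⟩ := exists_resolvent hl u
  set w := -Δ v with hwdef
  set c := Real.sin (Real.pi * s) / Real.pi with hc
  have hc0 : 0 ≤ c := div_nonneg (Real.sin_nonneg_of_nonneg_of_le_pi (by positivity)
    (by nlinarith [Real.pi_pos])) Real.pi_pos.le
  have hcc : ((√c : ℝ) : ℂ) * ((√c : ℝ) : ℂ) = (c : ℂ) := by
    rw [← Complex.ofReal_mul, Real.mul_self_sqrt hc0]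
  have hreg : reg s lam u = fun x => ((√c : ℝ) : ℂ) * v x := by
    ext x
    rw [reg, ← hv]
  have hu : ∀ x, u x = w x + lam * v x := fun x => by
    conv_lhs => rw [huv]
    rw [add_apply, smul_apply, Complex.real_smul]
  have hpu : ∀ k x, pd k u x = pd k w x + lam * pd k v x := fun k x => by
    have : (u : Ed d → ℂ) = fun y => w y + lam * v y := funext hu
    rw [← pd_const_mul, pd, this, fderiv_fun_add w.differentiableAt
      (v.differentiableAt.const_mul _)]
    rfl
  have hVF : virialForm φ u w = lam * ∑ k, ∫ x, (pdR k φ x : ℂ) *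
      ((starRingEnd ℂ) (w x) * pd k v x - (starRingEnd ℂ) (v x) * pd k w x) := by
    rw [virialForm_schwartz h, Finset.mul_sum]
    refine Finset.sum_congr rfl fun k _ => ?_
    rw [← integral_const_mul]
    congr 1
    ext x
    rw [hpu, hu, map_add, map_mul, Complex.conj_ofReal]
    ring
  have hpoint : ∀ x, (4 * ∑ j : Fin d, ∑ k : Fin d, ((pdR j (pdR k φ) x : ℝ) : ℂ) *
        (starRingEnd ℂ) (pd j (reg s lam u) x) * pd k (reg s lam u) x
        - ((lapR (lapR φ) x : ℝ) : ℂ) * ((‖reg s lam u x‖ ^ 2 : ℝ) : ℂ)) =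
      (c : ℂ) * (4 * ∑ j : Fin d, ∑ k : Fin d, ((pdR j (pdR k φ) x : ℝ) : ℂ) *
        (starRingEnd ℂ) (pd j v x) * pd k v x
        - ((lapR (lapR φ) x : ℝ) : ℂ) * ((‖v x‖ ^ 2 : ℝ) : ℂ)) := fun x => by
    have hn : ((‖((√c : ℝ) : ℂ) * v x‖ ^ 2 : ℝ) : ℂ) = c * ((‖v x‖ ^ 2 : ℝ) : ℂ) := by
      rw [norm_mul, mul_pow, Complex.norm_of_nonneg (Real.sqrt_nonneg c), Real.sq_sqrt hc0]
      push_cast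
      rfl
    rw [hreg]
    simp only [pd_const_mul, hn, map_mul, Complex.conj_ofReal]
    rw [mul_sub, mul_left_comm (c : ℂ) 4, Finset.mul_sum _ _ (c : ℂ)]
    congr 1
    · congr 1
      refine Finset.sum_congr rfl fun j _ => ?_
      rw [Finset.mul_sum, ← hcc]
      exact Finset.sum_congr rfl fun k _ => by ring
    · ring
  have hint := integrable_pdR_mul_conj_mul_pd h
  have hre : ∀ k, ∫ x, (pdR k φ x : ℂ) * ((2 * ((starRingEnd ℂ) (w x) * pd k v x -
        (starRingEnd ℂ) (v x) * pd k w x).re : ℝ) : ℂ) =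
      ((2 * (∫ x, (pdR k φ x : ℂ) * ((starRingEnd ℂ) (w x) * pd k v x -
        (starRingEnd ℂ) (v x) * pd k w x)).re : ℝ) : ℂ) := fun k => by
    have hi : Integrable fun x => (pdR k φ x : ℂ) * ((starRingEnd ℂ) (w x) * pd k v x -
        (starRingEnd ℂ) (v x) * pd k w x) := by
      simp_rw [mul_sub]
      exact (hint w v k).sub (hint v w k)
    rw [← RCLike.re_eq_complex_re, ← integral_re hi, ← integral_const_mul,
      ← integral_complex_ofReal]
    congr 1
    ext x
    rw [RCLike.re_eq_complex_re, Complex.re_ofReal_mul]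
    push_cast
    ring
  simp_rw [hpoint]
  rw [integral_const_mul, virial_laplacian h v, ← hw, hVF]
  simp_rw [← hwdef, hre]
  rw [Complex.re_ofReal_mul, Complex.re_sum]
  push_cast
  rw [← Finset.mul_sum]
  ring

end Multiplier

theorem stmt11 (d : ℕ) (hd : 1 ≤ d) (s : ℝ) (hs0 : 0 < s) (hs1 : s < 1)
    (u : SchwartzMap (Ed d) ℂ) (φ : Ed d → ℝ) (hφ : ContDiff ℝ (⊤ : ℕ∞) φ)
    (hbd : ∀ n : ℕ, 1 ≤ n → n ≤ 4 → ∃ M : ℝ, ∀ x : Ed d, ‖iteratedFDeriv ℝ n φ x‖ ≤ M) :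
    (((2 * (∫ x : Ed d, (starRingEnd ℂ) (fracD (2 * s) (⇑u) x) *
            ∑ j : Fin d, pd j (⇑u) x * ((pdR j φ x : ℝ) : ℂ)).re
       - 2 * (∫ x : Ed d, (starRingEnd ℂ) (u x) *
            ∑ j : Fin d, pd j (fracD (2 * s) (⇑u)) x * ((pdR j φ x : ℝ) : ℂ)).re : ℝ)) : ℂ)
    = ∫ lam in Set.Ioi (0:ℝ), ((lam ^ s : ℝ) : ℂ) *
        ∫ x : Ed d,
          (4 * ∑ j : Fin d, ∑ k : Fin d, ((pdR j (pdR k φ) x : ℝ) : ℂ) *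
              (starRingEnd ℂ) (pd j (reg s lam (⇑u)) x) * pd k (reg s lam (⇑u)) x
            - ((lapR (lapR φ) x : ℝ) : ℂ) * ((‖reg s lam (⇑u) x‖ ^ 2 : ℝ) : ℂ)) := by
  have h : BoundedDerivs 1 4 φ := ⟨hφ, hbd⟩
  have hsin : 0 < Real.sin (Real.pi * s) :=
    Real.sin_pos_of_pos_of_lt_pi (by positivity) (by nlinarith [Real.pi_pos])
  obtain ⟨hi, he⟩ := integral_virialForm_resolvent hs0 hs1 h u
  set V : ℝ → ℂ := fun lam => virialForm φ u (multiplier (fun η =>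
        (2 * Real.pi * ‖η‖) ^ 2 / ((2 * Real.pi * ‖η‖) ^ 2 + lam)) u) with hV
  set c := Real.sin (Real.pi * s) / Real.pi with hc
  have hR : ∀ lam ∈ Set.Ioi (0 : ℝ), ((lam ^ s : ℝ) : ℂ) *
        ∫ x : Ed d,
          (4 * ∑ j : Fin d, ∑ k : Fin d, ((pdR j (pdR k φ) x : ℝ) : ℂ) *
              (starRingEnd ℂ) (pd j (reg s lam (⇑u)) x) * pd k (reg s lam (⇑u)) x
            - ((lapR (lapR φ) x : ℝ) : ℂ) * ((‖reg s lam (⇑u) x‖ ^ 2 : ℝ) : ℂ)) =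
      ((2 * c * (((lam ^ (s - 1) : ℝ) : ℂ) * V lam).re : ℝ) : ℂ) := fun lam hl => by
    have hl : 0 < lam := hl
    have hp : lam ^ s = lam ^ (s - 1) * lam := by
      rw [← Real.rpow_add_one hl.ne', sub_add_cancel]
    rw [hp, Complex.ofReal_mul, mul_assoc, integral_virial_reg hs0 hs1 hl h u,
      ← Complex.ofReal_mul, Complex.re_ofReal_mul]
    congr 1
    ring
  have hre : ∫ lam in Set.Ioi (0 : ℝ), (((lam ^ (s - 1) : ℝ) : ℂ) * V lam).re =
      (∫ lam in Set.Ioi (0 : ℝ), ((lam ^ (s - 1) : ℝ) : ℂ) * V lam).re := integral_re hi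
  rw [setIntegral_congr_fun measurableSet_Ioi hR, integral_complex_ofReal, integral_const_mul,
    hre, he, Complex.re_ofReal_mul, virialForm, Complex.sub_re]
  have hcs : c * (Real.pi / Real.sin (Real.pi * s)) = 1 := by
    rw [hc, div_mul_div_cancel₀ Real.pi_ne_zero, div_self hsin.ne']
  rw [mul_assoc 2 c, ← mul_assoc c, hcs, one_mul, mul_sub]

end
end

section
/- Let $d \ge 3$, $\frac{1}{2} < s < 1$, and let $\chi \in C_c^\infty(\mathbb{R}^d; \mathbb{R})$. There is a constant $C = C(d, s, \chi)$ such that for every Schwartz function $u$ on $\mathbb{R}^d$ and every $R > 0$: $\left| \int_0^\infty \lambda^s \left( \int_{\mathbb{R}^d} \chi_R(x)\, \Delta\chi_R(x)\, |u_\lambda(x)|^2\, dx \right) d\lambda \right| \le C\, \|u\|_{L^2(\mathbb{R}^d)}^2\, R^{-2s}$, where $\chi_R(x) := \chi(x/R)$. -/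
open MeasureTheory Complex
open scoped ENNReal BigOperators RealInnerProductSpace

noncomputable section

lemma toReal_eLpNorm_two_sq {α F : Type*} [MeasurableSpace α] {μ : Measure α}
    [NormedAddCommGroup F] {f : α → F} (hf : MemLp f 2 μ) :
    (eLpNorm f 2 μ).toReal ^ 2 = ∫ x, ‖f x‖ ^ 2 ∂μ := by
  rw [hf.eLpNorm_eq_integral_rpow_norm (by norm_num) (by norm_num)]
  have h : 0 ≤ ∫ x, ‖f x‖ ^ 2 ∂μ := integral_nonneg fun _ => by positivity
  simp only [ENNReal.toReal_ofNat, Real.rpow_ofNat]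
  rw [ENNReal.toReal_ofReal (by positivity), ← Real.rpow_natCast, ← Real.rpow_mul h]
  norm_num

open scoped FourierTransform SchwartzMap in
/-- On `L¹ ∩ L²` the integral Fourier transform agrees with the `L²` Fourier transform. -/
lemma fourier_ae_eq_fourier_toLp {E : Type*} [NormedAddCommGroup E] [InnerProductSpace ℝ E]
    [FiniteDimensional ℝ E] [MeasurableSpace E] [BorelSpace E] {g : E → ℂ}
    (hg : Integrable g) (hg2 : MemLp g 2) :
    𝓕 g =ᵐ[volume] (𝓕 (hg2.toLp g) : Lp (α := E) ℂ 2) := by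
  have hcont : Continuous (𝓕 g) := VectorFourier.fourierIntegral_continuous
    Real.continuous_fourierChar (by exact continuous_inner) hg
  refine ae_eq_of_integral_contDiff_smul_eq hcont.locallyIntegrable
    ((Lp.memLp _).locallyIntegrable (by norm_num)) fun φ hφ hφc => ?_
  let ψ : 𝓢(E, ℂ) := HasCompactSupport.toSchwartzMap (f := fun x => (φ x : ℂ))
    (hφc.comp_left (g := Complex.ofReal) rfl) (Complex.ofRealCLM.contDiff.comp hφ)
  have hψ : ∀ x, ψ x = (φ x : ℂ) := fun _ => rfl
  have h := congrArg (fun T : TemperedDistribution E ℂ => T ψ)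
    (Lp.fourier_toTemperedDistribution_eq (hg2.toLp g))
  simp only [TemperedDistribution.fourier_apply, Lp.toTemperedDistribution_apply, hψ] at h
  have h2 : ∫ x, 𝓕 (ψ : E → ℂ) x • g x = ∫ x, ψ x • 𝓕 g x := by
    simpa using! VectorFourier.integral_fourierIntegral_smul_eq_flip (L := innerₗ E)
      Real.continuous_fourierChar continuous_inner ψ.integrable hg
  have h3 : ∫ x, 𝓕 ψ x • (hg2.toLp g) x = ∫ x, 𝓕 (ψ : E → ℂ) x • g x := by
    refine integral_congr_ae ?_
    filter_upwards [hg2.coeFn_toLp] with x hx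
    rw [hx, SchwartzMap.fourier_coe]
  rw [h3, h2] at h
  simpa [hψ] using h

open scoped FourierTransform in
lemma memLp_fourier {E : Type*} [NormedAddCommGroup E] [InnerProductSpace ℝ E]
    [FiniteDimensional ℝ E] [MeasurableSpace E] [BorelSpace E] {g : E → ℂ}
    (hg : Integrable g) (hg2 : MemLp g 2) : MemLp (𝓕 g) 2 :=
  (memLp_congr_ae (fourier_ae_eq_fourier_toLp hg hg2)).2 (Lp.memLp _)

open scoped FourierTransform in
/-- Plancherel's identity for the integral Fourier transform on `L¹ ∩ L²`. -/
lemma integral_norm_sq_fourier_eq {E : Type*} [NormedAddCommGroup E] [InnerProductSpace ℝ E]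
    [FiniteDimensional ℝ E] [MeasurableSpace E] [BorelSpace E] {g : E → ℂ}
    (hg : Integrable g) (hg2 : MemLp g 2) : ∫ ξ, ‖𝓕 g ξ‖ ^ 2 = ∫ x, ‖g x‖ ^ 2 := by
  rw [← toReal_eLpNorm_two_sq (memLp_fourier hg hg2), ← toReal_eLpNorm_two_sq hg2,
    eLpNorm_congr_ae (fourier_ae_eq_fourier_toLp hg hg2), ← Lp.norm_def, Lp.norm_fourier_eq,
    Lp.norm_toLp]

open scoped FourierTransform in
lemma FT_eq_fourier {d : ℕ} (f : Ed d → ℂ) (ξ : Ed d) :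
    FT f ξ = 𝓕 f ((2 * Real.pi)⁻¹ • ξ) := by
  rw [FT, Real.fourier_eq']
  refine integral_congr_ae (.of_forall fun x => ?_)
  simp only [smul_eq_mul, inner_smul_right]
  congr 2
  push_cast
  have : (Real.pi : ℂ) ≠ 0 := by exact_mod_cast Real.pi_ne_zero
  field_simp

open scoped FourierTransform in
lemma FTinv_eq_fourier {d : ℕ} (g : Ed d → ℂ) (x : Ed d) :
    FTinv g x = (((2 * Real.pi) ^ (-(d : ℝ)) : ℝ) : ℂ) * 𝓕 g ((-(2 * Real.pi)⁻¹) • x) := by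
  rw [FTinv, Real.fourier_eq']
  congr 1
  refine integral_congr_ae (.of_forall fun ξ => ?_)
  simp only [smul_eq_mul, inner_smul_right, real_inner_comm]
  congr 2
  push_cast
  have : (Real.pi : ℂ) ≠ 0 := by exact_mod_cast Real.pi_ne_zero
  field_simp

lemma integrable_FT {d : ℕ} (u : SchwartzMap (Ed d) ℂ) : Integrable (FT (⇑u)) := by
  simp only [funext (FT_eq_fourier (⇑u)), ← SchwartzMap.fourier_coe]
  exact (SchwartzMap.integrable _).comp_smul (by positivity)

lemma memLp_FT {d : ℕ} (u : SchwartzMap (Ed d) ℂ) : MemLp (FT (⇑u)) 2 := by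
  rw [memLp_two_iff_integrable_sq_norm (integrable_FT u).aestronglyMeasurable]
  simp only [FT_eq_fourier, ← SchwartzMap.fourier_coe]
  exact ((SchwartzMap.memLp _ 2 volume).integrable_norm_pow (by norm_num)).comp_smul
    (R := (2 * Real.pi)⁻¹) (by positivity)

lemma integral_norm_sq_FT {d : ℕ} (u : SchwartzMap (Ed d) ℂ) :
    ∫ ξ, ‖FT (⇑u) ξ‖ ^ 2 = (2 * Real.pi) ^ d * ∫ x, ‖u x‖ ^ 2 := by
  simp only [FT_eq_fourier, ← SchwartzMap.fourier_coe]
  rw [Measure.integral_comp_inv_smul_of_nonneg volume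
    (fun ξ => ‖(FourierTransform.fourier u : SchwartzMap (Ed d) ℂ) ξ‖ ^ 2) (by positivity),
    SchwartzMap.integral_norm_sq_fourier]
  simp

lemma memLp_FTinv {d : ℕ} {g : Ed d → ℂ} (hg : Integrable g) (hg2 : MemLp g 2) :
    MemLp (FTinv g) 2 := by
  rw [funext (FTinv_eq_fourier g)]
  refine MemLp.const_mul ?_ _
  have h := memLp_fourier hg hg2
  have hc : Continuous (FourierTransform.fourier g) := VectorFourier.fourierIntegral_continuous
    Real.continuous_fourierChar (by exact continuous_inner) hg
  rw [memLp_two_iff_integrable_sq_norm (by fun_prop)]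
  exact (h.integrable_norm_pow (by norm_num)).comp_smul
    (R := -(2 * Real.pi)⁻¹) (neg_ne_zero.2 (by positivity))

lemma integral_norm_sq_FTinv {d : ℕ} {g : Ed d → ℂ} (hg : Integrable g) (hg2 : MemLp g 2) :
    ∫ x, ‖FTinv g x‖ ^ 2 = ((2 * Real.pi) ^ d)⁻¹ * ∫ ξ, ‖g ξ‖ ^ 2 := by
  have hp : 0 < (2 * Real.pi) ^ d := by positivity
  simp only [FTinv_eq_fourier, norm_mul, mul_pow]
  rw [integral_const_mul, Measure.integral_comp_smul volume
    (fun ξ => ‖(FourierTransform.fourier g) ξ‖ ^ 2), integral_norm_sq_fourier_eq hg hg2,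
    finrank_euclideanSpace_fin, smul_eq_mul, ← mul_assoc, abs_inv, abs_pow, abs_neg,
    abs_of_pos (inv_pos.2 Real.two_pi_pos), Complex.norm_real, Real.norm_eq_abs,
    Real.rpow_neg Real.two_pi_pos.le, Real.rpow_natCast, abs_of_pos (inv_pos.2 hp)]
  congr 1
  rw [inv_pow (2 * Real.pi) d, mul_pow]
  field_simp

lemma norm_FTinv_le {d : ℕ} (g : Ed d → ℂ) (x : Ed d) :
    ‖FTinv g x‖ ≤ ((2 * Real.pi) ^ d)⁻¹ * ∫ ξ, ‖g ξ‖ := by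
  have hp : 0 < (2 * Real.pi) ^ d := by positivity
  rw [FTinv, norm_mul, Complex.norm_real, Real.norm_eq_abs,
    Real.rpow_neg Real.two_pi_pos.le, Real.rpow_natCast, abs_of_pos (inv_pos.2 hp)]
  gcongr
  refine (norm_integral_le_integral_norm _).trans_eq (integral_congr_ae (.of_forall fun ξ => ?_))
  simp only [norm_mul, mul_comm Complex.I, Complex.norm_exp_ofReal_mul_I, one_mul]

lemma FTinv_add {d : ℕ} {g h : Ed d → ℂ} (hg : Integrable g) (hh : Integrable h) (x : Ed d) :
    FTinv (g + h) x = FTinv g x + FTinv h x := by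
  have key : ∀ {f : Ed d → ℂ}, Integrable f →
      Integrable fun ξ : Ed d => Complex.exp (Complex.I * ((⟪x, ξ⟫ : ℝ) : ℂ)) * f ξ := by
    intro f hf
    refine hf.bdd_mul (c := 1) (by fun_prop) (.of_forall fun ξ => ?_)
    simp only [mul_comm Complex.I, Complex.norm_exp_ofReal_mul_I, le_refl]
  simp only [FTinv, Pi.add_apply, mul_add]
  rw [integral_add (key hg) (key hh), mul_add]

lemma sq_integral_mul_le {α : Type*} [MeasurableSpace α] {μ : Measure α} {f g : α → ℝ}
    (hf0 : 0 ≤ f) (hg0 : 0 ≤ g) (hf : MemLp f 2 μ) (hg : MemLp g 2 μ) :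
    (∫ x, f x * g x ∂μ) ^ 2 ≤ (∫ x, f x ^ 2 ∂μ) * ∫ x, g x ^ 2 ∂μ := by
  have h := integral_mul_le_Lp_mul_Lq_of_nonneg (μ := μ) Real.HolderConjugate.two_two
    (.of_forall hf0) (.of_forall hg0) (by simpa using hf) (by simpa using hg)
  simp only [Real.rpow_ofNat, ← Real.sqrt_eq_rpow] at h
  have h0 : 0 ≤ ∫ x, f x * g x ∂μ := integral_nonneg fun x => mul_nonneg (hf0 x) (hg0 x)
  calc _ ≤ (√(∫ x, f x ^ 2 ∂μ) * √(∫ x, g x ^ 2 ∂μ)) ^ 2 := by gcongr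
    _ = _ := by
      rw [mul_pow, Real.sq_sqrt (integral_nonneg fun _ => sq_nonneg _),
        Real.sq_sqrt (integral_nonneg fun _ => sq_nonneg _)]

/-- In dimension at least three, `|ξ|⁻²` is locally integrable at the origin. -/
lemma integrableOn_inv_norm_sq_ball {d : ℕ} (hd : 3 ≤ d) (r : ℝ) :
    IntegrableOn (fun ξ : Ed d => (‖ξ‖ ^ 2)⁻¹) (Metric.ball 0 r) := by
  have : Nontrivial (Ed d) := Module.nontrivial_of_finrank_pos (R := ℝ) (by simp; lia)
  rw [integrableOn_fun_norm_addHaar volume (f := fun y : ℝ => (y ^ 2)⁻¹)]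
  have h : IntegrableOn (fun y : ℝ => y ^ (d - 3)) (Set.Ioo 0 r) :=
    (Continuous.integrableOn_Icc (by fun_prop)).mono_set Set.Ioo_subset_Icc_self
  refine h.congr_fun (fun y hy => ?_) measurableSet_Ioo
  have hy0 : y ≠ 0 := hy.1.ne'
  obtain ⟨k, rfl⟩ := Nat.exists_eq_add_of_le hd
  simp only [finrank_euclideanSpace_fin, smul_eq_mul]
  rw [show 3 + k - 1 = k + 2 by lia, show 3 + k - 3 = k by lia, pow_add]
  field_simp

lemma setIntegral_inv_norm_sq_ball (d : ℕ) {R : ℝ} (hR : 0 < R) :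
    ∫ ξ in Metric.ball (0 : Ed d) R⁻¹, (‖ξ‖ ^ 2)⁻¹ =
      R ^ 2 * (R ^ d)⁻¹ * ∫ ξ in Metric.ball (0 : Ed d) 1, (‖ξ‖ ^ 2)⁻¹ := by
  have h := Measure.setIntegral_comp_smul_of_pos volume (fun ξ : Ed d => (‖ξ‖ ^ 2)⁻¹)
    (Metric.ball 0 R⁻¹) hR
  rw [smul_ball hR.ne', smul_zero, Real.norm_of_nonneg hR.le, mul_inv_cancel₀ hR.ne'] at h
  simp only [norm_smul, mul_pow, mul_inv, integral_const_mul, Real.norm_of_nonneg hR.le,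
    finrank_euclideanSpace_fin, smul_eq_mul] at h
  rw [mul_assoc, ← h]
  field_simp

/-- The Fourier transform of `(-Δ + λ)⁻¹ u`. -/
def resolvSymbol {d : ℕ} (lam : ℝ) (f : Ed d → ℂ) (ξ : Ed d) : ℂ :=
  FT f ξ / ((‖ξ‖ ^ 2 + lam : ℝ) : ℂ)

lemma norm_resolvSymbol {d : ℕ} {lam : ℝ} (hl : 0 < lam) (f : Ed d → ℂ) (ξ : Ed d) :
    ‖resolvSymbol lam f ξ‖ = ‖FT f ξ‖ * (‖ξ‖ ^ 2 + lam)⁻¹ := by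
  rw [resolvSymbol, norm_div, Complex.norm_real, Real.norm_of_nonneg (by positivity),
    div_eq_mul_inv]

lemma norm_resolvSymbol_le {d : ℕ} {lam : ℝ} (hl : 0 < lam) (f : Ed d → ℂ) (ξ : Ed d) :
    ‖resolvSymbol lam f ξ‖ ≤ lam⁻¹ * ‖FT f ξ‖ := by
  rw [norm_resolvSymbol hl, mul_comm]
  gcongr
  linarith [sq_nonneg ‖ξ‖]

lemma aestronglyMeasurable_resolvSymbol {d : ℕ} (lam : ℝ) (u : SchwartzMap (Ed d) ℂ) :
    AEStronglyMeasurable (resolvSymbol lam (⇑u)) volume :=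
  ((integrable_FT u).aemeasurable.div (by fun_prop)).aestronglyMeasurable

lemma integrable_resolvSymbol {d : ℕ} {lam : ℝ} (hl : 0 < lam) (u : SchwartzMap (Ed d) ℂ) :
    Integrable (resolvSymbol lam (⇑u)) :=
  ((integrable_FT u).norm.const_mul lam⁻¹).mono' (aestronglyMeasurable_resolvSymbol lam u)
    (.of_forall (norm_resolvSymbol_le hl _))

lemma memLp_resolvSymbol {d : ℕ} {lam : ℝ} (hl : 0 < lam) (u : SchwartzMap (Ed d) ℂ) :
    MemLp (resolvSymbol lam (⇑u)) 2 :=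
  ((memLp_FT u).norm.const_mul lam⁻¹).mono' (aestronglyMeasurable_resolvSymbol lam u)
    (.of_forall (norm_resolvSymbol_le hl _))

lemma memLp_resolv {d : ℕ} {lam : ℝ} (hl : 0 < lam) (u : SchwartzMap (Ed d) ℂ) :
    MemLp (resolv lam (⇑u)) 2 :=
  memLp_FTinv (integrable_resolvSymbol hl u) (memLp_resolvSymbol hl u)

lemma integral_norm_sq_resolv_le {d : ℕ} {lam : ℝ} (hl : 0 < lam) (u : SchwartzMap (Ed d) ℂ) :
    ∫ x, ‖resolv lam (⇑u) x‖ ^ 2 ≤ (lam ^ 2)⁻¹ * ∫ x, ‖u x‖ ^ 2 := by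
  have hp : 0 < (2 * Real.pi) ^ d := by positivity
  have h1 : ∫ x, ‖resolv lam (⇑u) x‖ ^ 2 =
      ((2 * Real.pi) ^ d)⁻¹ * ∫ ξ, ‖resolvSymbol lam (⇑u) ξ‖ ^ 2 :=
    integral_norm_sq_FTinv (integrable_resolvSymbol hl u) (memLp_resolvSymbol hl u)
  have h2 : ∫ ξ, ‖resolvSymbol lam (⇑u) ξ‖ ^ 2 ≤ (lam ^ 2)⁻¹ * ∫ ξ, ‖FT (⇑u) ξ‖ ^ 2 := by
    rw [← integral_const_mul]
    refine integral_mono ((memLp_resolvSymbol hl u).integrable_norm_pow (by norm_num))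
      (((memLp_FT u).integrable_norm_pow (by norm_num)).const_mul _) fun ξ => ?_
    calc ‖resolvSymbol lam (⇑u) ξ‖ ^ 2 ≤ (lam⁻¹ * ‖FT (⇑u) ξ‖) ^ 2 := by
          gcongr; exact norm_resolvSymbol_le hl _ _
      _ = (lam ^ 2)⁻¹ * ‖FT (⇑u) ξ‖ ^ 2 := by ring
  rw [h1, inv_mul_le_iff₀ hp]
  refine h2.trans_eq ?_
  rw [integral_norm_sq_FT]
  ring

lemma sq_inv_norm_sq_add_le {d : ℕ} {lam : ℝ} (hl : 0 < lam) {ξ : Ed d} (hξ : ξ ≠ 0) :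
    ((‖ξ‖ ^ 2 + lam)⁻¹) ^ 2 ≤ lam⁻¹ * (‖ξ‖ ^ 2)⁻¹ := by
  have : 0 < ‖ξ‖ := norm_pos_iff.2 hξ
  rw [← mul_inv, inv_pow]
  gcongr
  nlinarith [sq_nonneg (‖ξ‖ ^ 2), sq_nonneg lam, mul_pos hl (pow_pos this 2)]

lemma sq_integral_norm_resolvSymbol_ball_le {d : ℕ} (hd : 3 ≤ d) {lam R : ℝ} (hl : 0 < lam)
    (hR : 0 < R) (u : SchwartzMap (Ed d) ℂ) :
    (∫ ξ in Metric.ball 0 R⁻¹, ‖resolvSymbol lam (⇑u) ξ‖) ^ 2 ≤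
      ((2 * Real.pi) ^ d * ∫ x, ‖u x‖ ^ 2) *
        (lam⁻¹ * (R ^ 2 * (R ^ d)⁻¹ * ∫ ξ in Metric.ball (0 : Ed d) 1, (‖ξ‖ ^ 2)⁻¹)) := by
  have : Nontrivial (Ed d) := Module.nontrivial_of_finrank_pos (R := ℝ) (by simp; lia)
  set B : Set (Ed d) := Metric.ball 0 R⁻¹
  have : IsFiniteMeasure (volume.restrict B) := ⟨by simpa using measure_ball_lt_top⟩
  have hg : MemLp (fun ξ : Ed d => (‖ξ‖ ^ 2 + lam)⁻¹) 2 (volume.restrict B) := by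
    refine MemLp.of_bound (by fun_prop) lam⁻¹ (.of_forall fun ξ => ?_)
    rw [Real.norm_of_nonneg (by positivity)]
    gcongr
    linarith [sq_nonneg ‖ξ‖]
  have hf := (memLp_FT u).norm
  simp only [norm_resolvSymbol hl]
  refine (sq_integral_mul_le (fun _ => norm_nonneg _) (fun _ => by positivity)
    (hf.restrict B) hg).trans ?_
  rw [← integral_norm_sq_FT, ← setIntegral_inv_norm_sq_ball d hR,
    ← integral_const_mul lam⁻¹]
  refine mul_le_mul ?_ ?_ (integral_nonneg fun _ => by positivity)
    (integral_nonneg fun _ => by positivity)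
  · exact setIntegral_le_integral ((memLp_FT u).integrable_norm_pow (by norm_num))
      (.of_forall fun _ => by positivity)
  · refine integral_mono_ae hg.integrable_sq
      ((integrableOn_inv_norm_sq_ball hd R⁻¹).const_mul _) ?_
    filter_upwards [ae_restrict_of_ae (compl_mem_ae_iff.2 (measure_singleton (0 : Ed d)))]
      with ξ hξ
    exact sq_inv_norm_sq_add_le hl hξ

lemma integral_norm_sq_resolvSymbol_compl_ball_le {d : ℕ} {lam R : ℝ} (hl : 0 < lam)
    (hR : 0 < R) (u : SchwartzMap (Ed d) ℂ) :
    ∫ ξ, ‖(Metric.ball 0 R⁻¹)ᶜ.indicator (resolvSymbol lam (⇑u)) ξ‖ ^ 2 ≤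
      (R ^ 2 * lam⁻¹) * ((2 * Real.pi) ^ d * ∫ x, ‖u x‖ ^ 2) := by
  rw [← integral_norm_sq_FT, ← integral_const_mul]
  refine integral_mono (((memLp_resolvSymbol hl u).indicator
    Metric.isOpen_ball.measurableSet.compl).integrable_norm_pow (by norm_num))
    (((memLp_FT u).integrable_norm_pow (by norm_num)).const_mul _) fun ξ => ?_
  by_cases hξ : ξ ∈ (Metric.ball (0 : Ed d) R⁻¹)ᶜ
  · have hξR : R⁻¹ ≤ ‖ξ‖ := by simpa using hξ
    have hξ0 : ξ ≠ 0 := norm_pos_iff.1 ((inv_pos.2 hR).trans_le hξR)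
    simp only [Set.indicator_of_mem hξ, norm_resolvSymbol hl, mul_pow]
    rw [mul_comm]
    gcongr
    refine (sq_inv_norm_sq_add_le hl hξ0).trans ?_
    rw [mul_comm]
    gcongr
    calc (‖ξ‖ ^ 2)⁻¹ ≤ ((R⁻¹) ^ 2)⁻¹ := by gcongr
      _ = R ^ 2 := by simp
  · simp only [Set.indicator_of_notMem hξ]
    simp
    positivity

/-- The local `L²` bound for the resolvent obtained by splitting frequencies at `|ξ| = 1/R`. -/
lemma setIntegral_norm_sq_resolv_le {d : ℕ} (hd : 3 ≤ d) {lam R ρ : ℝ} (hl : 0 < lam)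
    (hR : 0 < R) (hρ : 0 ≤ ρ) (u : SchwartzMap (Ed d) ℂ) :
    ∫ x in Metric.closedBall 0 (R * ρ), ‖resolv lam (⇑u) x‖ ^ 2 ≤
      2 * (ρ ^ d * volume.real (Metric.ball (0 : Ed d) 1) * ((2 * Real.pi) ^ d)⁻¹ *
        (∫ ξ in Metric.ball (0 : Ed d) 1, (‖ξ‖ ^ 2)⁻¹) + 1) * (R ^ 2 * lam⁻¹) *
        ∫ x, ‖u x‖ ^ 2 := by
  have hp : 0 < (2 * Real.pi) ^ d := by positivity
  set N := ∫ x, ‖u x‖ ^ 2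
  set A := ∫ ξ in Metric.ball (0 : Ed d) 1, (‖ξ‖ ^ 2)⁻¹
  set K : Set (Ed d) := Metric.closedBall 0 (R * ρ)
  set B : Set (Ed d) := Metric.ball 0 R⁻¹
  have hBm : MeasurableSet B := Metric.isOpen_ball.measurableSet
  set g := resolvSymbol lam (⇑u)
  have hgi := integrable_resolvSymbol hl u
  have hg2 := memLp_resolvSymbol hl u
  set a := FTinv (B.indicator g)
  set b := FTinv (Bᶜ.indicator g)
  have hb2 : MemLp b 2 := memLp_FTinv (hgi.indicator hBm.compl) (hg2.indicator hBm.compl)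
  have hbi : Integrable fun x => ‖b x‖ ^ 2 := hb2.integrable_norm_pow (by norm_num)
  have hsplit : ∀ x, resolv lam (⇑u) x = a x + b x := fun x => by
    rw [← FTinv_add (hgi.indicator hBm) (hgi.indicator hBm.compl), Set.indicator_self_add_compl]
    rfl
  have ha : ∀ x, ‖a x‖ ^ 2 ≤ (((2 * Real.pi) ^ d)⁻¹) ^ 2 *
      (((2 * Real.pi) ^ d * N) * (lam⁻¹ * (R ^ 2 * (R ^ d)⁻¹ * A))) := fun x => by
    refine (pow_le_pow_left₀ (norm_nonneg _) (norm_FTinv_le _ x) 2).trans ?_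
    rw [mul_pow]
    gcongr
    simp only [norm_indicator_eq_indicator_norm]
    rw [integral_indicator hBm]
    exact sq_integral_norm_resolvSymbol_ball_le hd hl hR u
  set a₀ := (((2 * Real.pi) ^ d)⁻¹) ^ 2 *
      (((2 * Real.pi) ^ d * N) * (lam⁻¹ * (R ^ 2 * (R ^ d)⁻¹ * A)))
  have hb : ∫ x in K, ‖b x‖ ^ 2 ≤ R ^ 2 * lam⁻¹ * N := by
    refine (setIntegral_le_integral hbi (.of_forall fun _ => by positivity)).trans ?_
    rw [integral_norm_sq_FTinv (hgi.indicator hBm.compl) (hg2.indicator hBm.compl),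
      inv_mul_le_iff₀ hp]
    refine (integral_norm_sq_resolvSymbol_compl_ball_le hl hR u).trans_eq ?_
    ring
  have hKfin : volume K ≠ ∞ := measure_closedBall_lt_top.ne
  have hKvol : volume.real K = (R * ρ) ^ d * volume.real (Metric.ball (0 : Ed d) 1) := by
    rw [Measure.addHaar_real_closedBall _ _ (by positivity), finrank_euclideanSpace_fin]
  have hci : IntegrableOn (fun _ : Ed d => a₀) K := integrableOn_const hKfin
  calc ∫ x in K, ‖resolv lam (⇑u) x‖ ^ 2 ≤ ∫ x in K, 2 * (a₀ + ‖b x‖ ^ 2) := by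
        refine integral_mono ((memLp_resolv hl u).integrable_norm_pow (by norm_num)).integrableOn
          ((hci.add hbi.integrableOn).const_mul 2) fun x => ?_
        simp only [hsplit]
        have h1 := norm_add_le (a x) (b x)
        nlinarith [ha x, sq_nonneg (‖a x‖ - ‖b x‖), norm_nonneg (a x + b x)]
    _ = 2 * (volume.real K * a₀ + ∫ x in K, ‖b x‖ ^ 2) := by
        rw [integral_const_mul, integral_add hci hbi.integrableOn, setIntegral_const, smul_eq_mul]
    _ ≤ 2 * ((R * ρ) ^ d * volume.real (Metric.ball (0 : Ed d) 1) * a₀ + R ^ 2 * lam⁻¹ * N) := by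
        rw [hKvol]
        gcongr
    _ = _ := by
        simp only [a₀, mul_pow R ρ d]
        field_simp

lemma abs_integral_rpow_mul_le {s a D : ℝ} (hs0 : 0 < s) (hs1 : s < 1) (ha : 0 < a) {F : ℝ → ℝ}
    (hnear : ∀ lam, 0 < lam → |F lam| ≤ D * lam⁻¹)
    (hfar : ∀ lam, 0 < lam → |F lam| ≤ D * a * (lam ^ 2)⁻¹) :
    |∫ lam in Set.Ioi (0 : ℝ), lam ^ s * F lam| ≤ D * (1 / s + 1 / (1 - s)) * a ^ s := by
  have hi1 : IntegrableOn (fun t : ℝ => t ^ (s - 1)) (Set.Ioc 0 a) :=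
    (intervalIntegrable_iff_integrableOn_Ioc_of_le ha.le).1
      (intervalIntegral.intervalIntegrable_rpow' (by linarith))
  have hi2 : IntegrableOn (fun t : ℝ => t ^ (s - 2)) (Set.Ioi a) :=
    integrableOn_Ioi_rpow_of_lt (by linarith) ha
  have hv1 : ∫ t in Set.Ioc 0 a, t ^ (s - 1) = a ^ s / s := by
    rw [← intervalIntegral.integral_of_le ha.le, integral_rpow (.inl (by linarith)),
      sub_add_cancel, Real.zero_rpow hs0.ne', sub_zero]
  have hv2 : ∫ t in Set.Ioi a, t ^ (s - 2) = a ^ (s - 1) / (1 - s) := by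
    rw [integral_Ioi_rpow_of_lt (by linarith) ha, show s - 2 + 1 = s - 1 by ring, ← neg_sub 1 s,
      neg_div_neg_eq]
  have hsum := ((integrable_indicator_iff measurableSet_Ioc).2 (hi1.const_mul D)).add
    ((integrable_indicator_iff measurableSet_Ioi).2 (hi2.const_mul (D * a)))
  have hle := norm_integral_le_of_norm_le (μ := volume.restrict (Set.Ioi 0))
    (f := fun lam => lam ^ s * F lam) hsum.integrableOn <| by
    filter_upwards [ae_restrict_mem measurableSet_Ioi] with t ht
    have ht : 0 < t := ht
    rw [norm_mul, Real.norm_of_nonneg (by positivity), Real.norm_eq_abs, Pi.add_apply]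
    rcases le_or_gt t a with h | h
    · rw [Set.indicator_of_mem (Set.mem_Ioc.2 ⟨ht, h⟩),
        Set.indicator_of_notMem (by simpa using h),
        add_zero, Real.rpow_sub_one ht.ne']
      refine (mul_le_mul_of_nonneg_left (hnear t ht) (by positivity)).trans_eq ?_
      ring
    · rw [Set.indicator_of_notMem (by simp [h]), Set.indicator_of_mem (Set.mem_Ioi.2 h),
        zero_add, Real.rpow_sub ht, Real.rpow_ofNat]
      refine (mul_le_mul_of_nonneg_left (hfar t ht) (by positivity)).trans_eq ?_
      ring
  refine hle.trans_eq ?_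
  have hsub : ∀ S ⊆ Set.Ioi (0 : ℝ), Set.Ioi 0 ∩ S = S := fun S hS => Set.inter_eq_right.2 hS
  rw [integral_add' ((integrable_indicator_iff measurableSet_Ioc).2 (hi1.const_mul D)).integrableOn
    ((integrable_indicator_iff measurableSet_Ioi).2 (hi2.const_mul (D * a))).integrableOn,
    setIntegral_indicator measurableSet_Ioc, setIntegral_indicator measurableSet_Ioi,
    hsub _ Set.Ioc_subset_Ioi_self, hsub _ (Set.Ioi_subset_Ioi ha.le),
    integral_const_mul, integral_const_mul, hv1, hv2, Real.rpow_sub_one ha.ne']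
  have : 1 - s ≠ 0 := by linarith
  field_simp

lemma pdR_chiR {d : ℕ} (j : Fin d) (f : Ed d → ℝ) (R : ℝ) :
    pdR j (chiR f R) = R⁻¹ • chiR (pdR j f) R := by
  ext x
  exact congrArg (fun L => L (EuclideanSpace.single j 1)) (fderiv_comp_smul (f := f) (x := x) R⁻¹)

lemma lapR_chiR {d : ℕ} (f : Ed d → ℝ) (R : ℝ) :
    lapR (chiR f R) = (R ^ 2)⁻¹ • chiR (lapR f) R := by
  have h : ∀ j, pdR j (pdR j (chiR f R)) = (R ^ 2)⁻¹ • chiR (pdR j (pdR j f)) R := fun j => by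
    have hsmul : ∀ g : Ed d → ℝ, pdR j (R⁻¹ • g) = R⁻¹ • pdR j g := fun g => by
      ext x
      simp only [pdR]
      rw [fderiv_const_smul_field]
      rfl
    rw [pdR_chiR, hsmul, pdR_chiR, smul_smul, ← mul_inv, sq]
  ext x
  simp only [lapR, h, Pi.smul_apply, chiR, smul_eq_mul, Finset.mul_sum]

lemma contDiff_pdR {d : ℕ} (j : Fin d) {f : Ed d → ℝ} (hf : ContDiff ℝ (⊤ : ℕ∞) f) :
    ContDiff ℝ (⊤ : ℕ∞) (pdR j f) :=
  (hf.fderiv_right (m := (⊤ : ℕ∞)) (by simp)).clm_apply contDiff_const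

lemma continuous_lapR {d : ℕ} {f : Ed d → ℝ} (hf : ContDiff ℝ (⊤ : ℕ∞) f) :
    Continuous (lapR f) :=
  continuous_finsetSum _ fun j _ => (contDiff_pdR j (contDiff_pdR j hf)).continuous

lemma exists_abs_chiR_mul_lapR_le {d : ℕ} (χ : Ed d → ℝ) (hχ : ContDiff ℝ (⊤ : ℕ∞) χ)
    (hχc : HasCompactSupport χ) :
    ∃ M ρ : ℝ, 0 ≤ M ∧ 0 ≤ ρ ∧ ∀ R : ℝ, 0 < R → ∀ x,
      |chiR χ R x * lapR (chiR χ R) x| ≤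
        (Metric.closedBall 0 (R * ρ)).indicator (fun _ => M * (R ^ 2)⁻¹) x := by
  obtain ⟨M, hM⟩ := (hχ.continuous.mul (continuous_lapR hχ)).bounded_above_of_compact_support
    (hχc.mul_right (f' := lapR χ))
  obtain ⟨ρ, hρ⟩ := hχc.isCompact.isBounded.subset_closedBall 0
  refine ⟨M, max ρ 0, (norm_nonneg _).trans (hM 0), le_max_right _ _, fun R hR x => ?_⟩
  have hval : |chiR χ R x * lapR (chiR χ R) x| =
      |χ (R⁻¹ • x) * lapR χ (R⁻¹ • x)| * (R ^ 2)⁻¹ := by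
    rw [lapR_chiR, Pi.smul_apply, smul_eq_mul, mul_left_comm, mul_comm, abs_mul,
      abs_of_pos (by positivity : 0 < (R ^ 2)⁻¹)]
    rfl
  rw [hval]
  by_cases hx : x ∈ Metric.closedBall (0 : Ed d) (R * max ρ 0)
  · rw [Set.indicator_of_mem hx]
    gcongr
    exact hM _
  · rw [Set.indicator_of_notMem hx]
    have h0 : χ (R⁻¹ • x) = 0 := by
      by_contra hne
      refine hx ?_
      have := hρ (subset_tsupport χ hne)
      rw [mem_closedBall_zero_iff, norm_smul, norm_inv, Real.norm_of_nonneg hR.le,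
        inv_mul_le_iff₀ hR] at this
      rw [mem_closedBall_zero_iff]
      exact this.trans (by gcongr; exact le_max_left _ _)
    simp [h0]

theorem stmt13 (d : ℕ) (hd : 3 ≤ d) (s : ℝ) (hs : 1/2 < s) (hs1 : s < 1)
    (χ : Ed d → ℝ) (hχ : ContDiff ℝ (⊤ : ℕ∞) χ) (hχc : HasCompactSupport χ) :
    ∃ C : ℝ, 0 < C ∧ ∀ u : SchwartzMap (Ed d) ℂ, ∀ R : ℝ, 0 < R →
      |∫ lam in Set.Ioi (0:ℝ), lam ^ s *
          ∫ x : Ed d, chiR χ R x * lapR (chiR χ R) x * ‖reg s lam (⇑u) x‖ ^ 2|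
        ≤ C * (eLpNorm (⇑u) 2 volume).toReal ^ 2 * R ^ (-(2 * s)) := by
  obtain ⟨M, ρ, hM, hρ, hW⟩ := exists_abs_chiR_mul_lapR_le χ hχ hχc
  set c := √(Real.sin (Real.pi * s) / Real.pi)
  set T := 2 * (ρ ^ d * volume.real (Metric.ball (0 : Ed d) 1) * ((2 * Real.pi) ^ d)⁻¹ *
    (∫ ξ in Metric.ball (0 : Ed d) 1, (‖ξ‖ ^ 2)⁻¹) + 1)
  have hT1 : 1 ≤ T := by
    have : 0 ≤ ∫ ξ in Metric.ball (0 : Ed d) 1, (‖ξ‖ ^ 2)⁻¹ :=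
      integral_nonneg fun _ => by positivity
    have : 0 ≤ ρ ^ d * volume.real (Metric.ball (0 : Ed d) 1) * ((2 * Real.pi) ^ d)⁻¹ *
      (∫ ξ in Metric.ball (0 : Ed d) 1, (‖ξ‖ ^ 2)⁻¹) := by positivity
    linarith
  have hs0 : 0 < s := by linarith
  have hs1' : 0 < 1 - s := by linarith
  refine ⟨M * c ^ 2 * T * (1 / s + 1 / (1 - s)) + 1, by positivity, fun u R hR => ?_⟩
  rw [toReal_eLpNorm_two_sq (u.memLp 2 volume)]
  set N := ∫ x, ‖u x‖ ^ 2
  have hN : 0 ≤ N := integral_nonneg fun _ => by positivity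
  set K : Set (Ed d) := Metric.closedBall 0 (R * ρ)
  have hKm : MeasurableSet K := Metric.isClosed_closedBall.measurableSet
  have hinner : ∀ lam : ℝ, 0 < lam →
      |∫ x : Ed d, chiR χ R x * lapR (chiR χ R) x * ‖reg s lam (⇑u) x‖ ^ 2| ≤
        M * (R ^ 2)⁻¹ * c ^ 2 * ∫ x in K, ‖resolv lam (⇑u) x‖ ^ 2 := fun lam hl => by
    have hi : Integrable fun x => ‖resolv lam (⇑u) x‖ ^ 2 :=
      (memLp_resolv hl u).integrable_norm_pow (by norm_num)
    rw [← integral_indicator hKm, ← integral_const_mul, ← Real.norm_eq_abs]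
    refine norm_integral_le_of_norm_le ((hi.indicator hKm).const_mul _) (.of_forall fun x => ?_)
    have hreg : ‖reg s lam (⇑u) x‖ ^ 2 = c ^ 2 * ‖resolv lam (⇑u) x‖ ^ 2 := by
      rw [reg, norm_mul, mul_pow, Complex.norm_real, Real.norm_eq_abs, sq_abs]
    rw [hreg, Real.norm_eq_abs, abs_mul, abs_of_nonneg (by positivity : 0 ≤ c ^ 2 * _)]
    refine (mul_le_mul_of_nonneg_right (hW R hR x) (by positivity)).trans_eq ?_
    by_cases hx : x ∈ K
    · simp only [K, Set.indicator_of_mem hx]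
      ring
    · simp only [K, Set.indicator_of_notMem hx]
      ring
  have hfar : ∀ lam : ℝ, 0 < lam →
      |∫ x : Ed d, chiR χ R x * lapR (chiR χ R) x * ‖reg s lam (⇑u) x‖ ^ 2| ≤
        (M * c ^ 2 * T * N) * (R ^ 2)⁻¹ * (lam ^ 2)⁻¹ := fun lam hl => by
    calc _ ≤ M * (R ^ 2)⁻¹ * c ^ 2 * ((lam ^ 2)⁻¹ * N) := by
          refine (hinner lam hl).trans ?_
          gcongr
          exact (setIntegral_le_integral ((memLp_resolv hl u).integrable_norm_pow (by norm_num))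
            (.of_forall fun _ => by positivity)).trans (integral_norm_sq_resolv_le hl u)
      _ = (M * c ^ 2 * 1 * N) * (R ^ 2)⁻¹ * (lam ^ 2)⁻¹ := by ring
      _ ≤ _ := by gcongr
  have hnear : ∀ lam : ℝ, 0 < lam →
      |∫ x : Ed d, chiR χ R x * lapR (chiR χ R) x * ‖reg s lam (⇑u) x‖ ^ 2| ≤
        (M * c ^ 2 * T * N) * lam⁻¹ := fun lam hl => by
    calc _ ≤ M * (R ^ 2)⁻¹ * c ^ 2 * (T * (R ^ 2 * lam⁻¹) * N) := by
          refine (hinner lam hl).trans ?_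
          gcongr
          exact setIntegral_norm_sq_resolv_le hd hl hR hρ u
      _ = _ := by field_simp
  have hRs : ((R ^ 2)⁻¹) ^ s = R ^ (-(2 * s)) := by
    rw [Real.rpow_neg hR.le, Real.rpow_mul hR.le, Real.inv_rpow (by positivity), Real.rpow_ofNat]
  have key := abs_integral_rpow_mul_le hs0 hs1 (a := (R ^ 2)⁻¹) (by positivity) hnear hfar
  rw [hRs] at key
  refine key.trans ?_
  have : 0 ≤ N * R ^ (-(2 * s)) := by positivity
  linarith

end
end

section
/- Let $d \ge 1$, $0 < s < 1$, and let $Q$ be a Schwartz function on $\mathbb{R}^d$. Then the Pohozaev-type identity holds: $\mathrm{Re} \int_{\mathbb{R}^d} (x \cdot \nabla Q(x))\, \overline{(-\Delta)^s Q(x)}\, dx \;=\; -\frac{d - 2s}{2}\, \|Q\|_{\dot H^s}^2$. -/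
open MeasureTheory Complex
open scoped ENNReal BigOperators RealInnerProductSpace

noncomputable section

open scoped FourierTransform LineDeriv

open SchwartzMap

/-- `FT` as a continuous linear endomorphism of Schwartz space. -/
def schwartzFT (d : ℕ) : SchwartzMap (Ed d) ℂ →L[ℂ] SchwartzMap (Ed d) ℂ :=
  (compCLMOfContinuousLinearEquiv ℂ
    (ContinuousLinearEquiv.smulLeft (Units.mk0 (2 * Real.pi)⁻¹ (by positivity)))).comp
    (FourierTransform.fourierCLM ℂ (SchwartzMap (Ed d) ℂ))

lemma schwartzFT_apply_eq_fourier {d : ℕ} (f : SchwartzMap (Ed d) ℂ) (ξ : Ed d) :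
    schwartzFT d f ξ = 𝓕 f ((2 * Real.pi)⁻¹ • ξ) := rfl

lemma schwartzFT_apply {d : ℕ} (f : SchwartzMap (Ed d) ℂ) (ξ : Ed d) :
    schwartzFT d f ξ = FT f ξ := by
  rw [schwartzFT_apply_eq_fourier, fourier_coe, Real.fourier_eq', FT]
  refine integral_congr_ae (.of_forall fun x => ?_)
  have hpi : (Real.pi : ℂ) ≠ 0 := by exact_mod_cast Real.pi_ne_zero
  simp only [smul_eq_mul, inner_smul_right]
  congr 2
  push_cast
  field_simp

lemma hasTemperateGrowth_inner_right {d : ℕ} (v : Ed d) :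
    (fun x : Ed d => ⟪x, v⟫).HasTemperateGrowth := by fun_prop

lemma hasFDerivAt_inner_right {d : ℕ} (v ξ : Ed d) :
    HasFDerivAt (fun x : Ed d => ⟪x, v⟫) (innerSL ℝ v) ξ := by
  simp_rw [real_inner_comm v]
  exact (innerSL ℝ v).hasFDerivAt

lemma schwartzFT_lineDerivOp {d : ℕ} (f : SchwartzMap (Ed d) ℂ) (v ξ : Ed d) :
    schwartzFT d (∂_{v} f) ξ = I * (⟪ξ, v⟫ : ℝ) * schwartzFT d f ξ := by
  have hpi : (Real.pi : ℂ) ≠ 0 := by exact_mod_cast Real.pi_ne_zero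
  simp only [schwartzFT_apply_eq_fourier, fourier_lineDerivOp_eq, _root_.smul_apply,
    smulLeftCLM_apply_apply (hasTemperateGrowth_inner_right v), real_smul, smul_eq_mul,
    inner_smul_left, map_inv₀]
  simp
  field_simp

lemma lineDerivOp_schwartzFT {d : ℕ} (f : SchwartzMap (Ed d) ℂ) (v ξ : Ed d) :
    ∂_{v} (schwartzFT d f) ξ =
      -I * schwartzFT d (smulLeftCLM ℂ (fun x : Ed d => ⟪x, v⟫) f) ξ := by
  have hpi : (Real.pi : ℂ) ≠ 0 := by exact_mod_cast Real.pi_ne_zero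
  have h : ∂_{v} (schwartzFT d f) ξ =
      ∂_{(2 * Real.pi)⁻¹ • v} (𝓕 f) ((2 * Real.pi)⁻¹ • ξ) := by
    simp only [schwartzFT, ContinuousLinearMap.comp_apply,
      lineDerivOp_compCLMOfContinuousLinearEquiv]
    rfl
  rw [h, LineDeriv.lineDerivOp_left_smul, lineDerivOp_fourier_eq, schwartzFT_apply_eq_fourier,
    FourierTransform.fourier_smul, _root_.smul_apply, _root_.smul_apply, real_smul,
    smul_eq_mul]
  push_cast
  field_simp

/-- On the Fourier side, `⟪x, v⟫ ∂_v` becomes `-‖v‖² - ⟪ξ, v⟫ ∂_v`. -/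
lemma schwartzFT_inner_smul_lineDerivOp {d : ℕ} (f : SchwartzMap (Ed d) ℂ) (v ξ : Ed d) :
    schwartzFT d (smulLeftCLM ℂ (fun x : Ed d => ⟪x, v⟫) (∂_{v} f)) ξ =
      -((‖v‖ ^ 2 : ℝ) * schwartzFT d f ξ + (⟪ξ, v⟫ : ℝ) * ∂_{v} (schwartzFT d f) ξ) := by
  have h1 := lineDerivOp_schwartzFT (∂_{v} f) v ξ
  have h2 : schwartzFT d (∂_{v} f) =
      I • smulLeftCLM ℂ (fun x : Ed d => ⟪x, v⟫) (schwartzFT d f) := by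
    ext η
    rw [schwartzFT_lineDerivOp, _root_.smul_apply,
      smulLeftCLM_apply_apply (hasTemperateGrowth_inner_right v), real_smul, smul_eq_mul, mul_assoc]
  have h3 : ∂_{v} (schwartzFT d (∂_{v} f)) ξ =
      I * ((‖v‖ ^ 2 : ℝ) * schwartzFT d f ξ + (⟪ξ, v⟫ : ℝ) * ∂_{v} (schwartzFT d f) ξ) := by
    rw [h2, LineDeriv.lineDerivOp_smul, _root_.smul_apply, lineDerivOp_apply_eq_fderiv,
      lineDerivOp_apply_eq_fderiv, smulLeftCLM_apply (hasTemperateGrowth_inner_right v)]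
    rw [((hasFDerivAt_inner_right v ξ).fun_smul
      (schwartzFT d f).differentiableAt.hasFDerivAt).fderiv]
    simp
    ring
  rw [h1] at h3
  linear_combination I * h3 + (schwartzFT d (smulLeftCLM ℂ (fun x : Ed d => ⟪x, v⟫) (∂_{v} f)) ξ +
    ((‖v‖ ^ 2 : ℝ) * schwartzFT d f ξ + (⟪ξ, v⟫ : ℝ) * ∂_{v} (schwartzFT d f) ξ)) * I_sq

lemma integrable_growth_mul_schwartz {d : ℕ} {m : Ed d → ℝ} (hm : AEStronglyMeasurable m volume)
    {C : ℝ} {k : ℕ} (hC : ∀ ξ, |m ξ| ≤ C * (1 + ‖ξ‖ ^ k)) (f : SchwartzMap (Ed d) ℂ) :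
    Integrable (fun ξ => (m ξ : ℂ) * f ξ) := by
  have h := ((f.integrable_pow_mul volume 0).add (f.integrable_pow_mul volume k)).const_mul C
  refine h.mono' ((continuous_ofReal.comp_aestronglyMeasurable hm).mul
    f.continuous.aestronglyMeasurable) (.of_forall fun ξ => ?_)
  rw [norm_mul, norm_real, Real.norm_eq_abs]
  calc |m ξ| * ‖f ξ‖ ≤ C * (1 + ‖ξ‖ ^ k) * ‖f ξ‖ := by gcongr; exact hC ξ
    _ = _ := by simp; ring

lemma integrable_growth_mul_schwartz_mul_conj {d : ℕ} {m : Ed d → ℝ}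
    (hm : AEStronglyMeasurable m volume) {C : ℝ} {k : ℕ} (hC : ∀ ξ, |m ξ| ≤ C * (1 + ‖ξ‖ ^ k))
    (f g : SchwartzMap (Ed d) ℂ) :
    Integrable (fun ξ => (m ξ : ℂ) * (f ξ * (starRingEnd ℂ) (g ξ))) := by
  obtain ⟨B, -, hB⟩ := g.decay 0 0
  simp only [← mul_assoc]
  refine (integrable_growth_mul_schwartz hm hC f).mul_bdd (c := B)
    (continuous_conj.comp g.continuous).aestronglyMeasurable (.of_forall fun ξ => ?_)
  simpa using hB ξ

lemma integral_mul_conj_FTinv {d : ℕ} (f : SchwartzMap (Ed d) ℂ) {g : Ed d → ℂ}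
    (hg : Integrable g) :
    ∫ x, f x * (starRingEnd ℂ) (FTinv g x) =
      (((2 * Real.pi) ^ (-(d : ℝ)) : ℝ) : ℂ) * ∫ ξ, FT f ξ * (starRingEnd ℂ) (g ξ) := by
  have hconj : Integrable (fun ξ => (starRingEnd ℂ) (g ξ)) := by
    simpa using (conjCLE : ℂ →L[ℝ] ℂ).integrable_comp hg
  have hprod : Integrable (Function.uncurry fun x ξ : Ed d =>
      Complex.exp (-I * ((⟪x, ξ⟫ : ℝ) : ℂ)) * (f x * (starRingEnd ℂ) (g ξ)))
      (volume.prod volume) := by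
    refine (f.integrable.mul_prod hconj).bdd_mul (c := 1)
      (Continuous.aestronglyMeasurable (by fun_prop)) (.of_forall fun p => ?_)
    rw [norm_exp]; simp
  have key (x : Ed d) : f x * (starRingEnd ℂ) (FTinv g x) =
      (((2 * Real.pi) ^ (-(d : ℝ)) : ℝ) : ℂ) *
        ∫ ξ, Complex.exp (-I * ((⟪x, ξ⟫ : ℝ) : ℂ)) * (f x * (starRingEnd ℂ) (g ξ)) := by
    rw [FTinv, map_mul, conj_ofReal, ← integral_conj, mul_left_comm, ← integral_const_mul]
    congr 2 with ξ
    rw [map_mul, ← exp_conj, map_mul, conj_I, conj_ofReal]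
    ring
  simp_rw [key]
  rw [integral_const_mul, integral_integral_swap hprod]
  congr 2 with ξ
  rw [FT, ← integral_mul_const]
  congr 1 with x
  ring

lemma norm_rpow_le_one_add_pow {d k : ℕ} {p : ℝ} (hp : 0 ≤ p) (hpk : p ≤ k) (ξ : Ed d) :
    ‖ξ‖ ^ p ≤ 1 + ‖ξ‖ ^ k := by
  rcases le_total ‖ξ‖ 1 with h | h
  · exact (Real.rpow_le_one (norm_nonneg _) h hp).trans (by simp)
  · exact (Real.rpow_le_rpow_of_exponent_le h hpk).trans (by simp)

lemma hasFDerivAt_norm_rpow_mul_inner {d : ℕ} {p : ℝ} (hp : 0 < p) (v ξ : Ed d) :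
    HasFDerivAt (fun η : Ed d => ‖η‖ ^ p * ⟪η, v⟫)
      (‖ξ‖ ^ p • innerSL ℝ v + (p * ‖ξ‖ ^ (p - 2) * ⟪ξ, v⟫) • innerSL ℝ ξ) ξ := by
  rcases eq_or_ne ξ 0 with rfl | hξ
  · have h0 : (fun η : Ed d => ‖η‖ ^ p) =o[nhds 0] (fun _ => (1 : ℝ)) := by
      rw [Asymptotics.isLittleO_one_iff]
      have : Continuous fun η : Ed d => ‖η‖ ^ p := by fun_prop (disch := exact hp.le)
      simpa [hp.ne'] using this.tendsto 0
    have h1 : (fun η : Ed d => ⟪η, v⟫) =O[nhds 0] fun η => ‖η‖ :=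
      by
      simp_rw [real_inner_comm v]
      exact ((innerSL ℝ v).isBigO_id _).norm_right
    have h2 := h0.mul_isBigO h1
    simp only [one_mul] at h2
    refine .of_isLittleO ?_
    simpa [hp.ne'] using h2.of_norm_right
  · have hsq := (hasStrictFDerivAt_norm_sq ξ).hasFDerivAt.rpow_const (p := p / 2)
      (Or.inl (by positivity))
    have hpow (η : Ed d) (q : ℝ) : (‖η‖ ^ 2) ^ q = ‖η‖ ^ (2 * q) := by
      rw [Real.rpow_mul (norm_nonneg _), Real.rpow_two]
    have e1 : 2 * (p / 2) = p := by ring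
    have e2 : 2 * (p / 2 - 1) = p - 2 := by ring
    simp only [hpow, e1, e2] at hsq
    refine (hsq.fun_mul (hasFDerivAt_inner_right v ξ)).congr_fderiv ?_
    ext w
    simp
    ring

lemma norm_rpow_sub_two_mul_sq {d : ℕ} {p : ℝ} (hp : 0 < p) (ξ : Ed d) :
    ‖ξ‖ ^ (p - 2) * ‖ξ‖ ^ 2 = ‖ξ‖ ^ p := by
  rcases eq_or_ne ξ 0 with rfl | hξ
  · simp [hp.ne']
  · rw [← Real.rpow_two, ← Real.rpow_add (norm_pos_iff.2 hξ), sub_add_cancel]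

/-- Integrability against `∂_v (‖ξ‖ ^ p * ⟪ξ, v⟫)` for a unit vector `v`. -/
lemma integrable_divergence_weight_mul_norm_sq {d : ℕ} {p : ℝ} (hp : 0 < p) {v : Ed d}
    (hv : ‖v‖ = 1) (f : SchwartzMap (Ed d) ℂ) :
    Integrable fun ξ => (‖ξ‖ ^ p + p * ‖ξ‖ ^ (p - 2) * ⟪ξ, v⟫ ^ 2) * ‖f ξ‖ ^ 2 := by
  have hmeas {q : ℝ} : Measurable fun ξ : Ed d => ‖ξ‖ ^ q := by fun_prop
  have hinner (ξ : Ed d) : |⟪ξ, v⟫| ≤ ‖ξ‖ := by simpa [hv] using abs_real_inner_le_norm ξ v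
  obtain ⟨k, hk⟩ := exists_nat_ge p
  have hgrow (ξ : Ed d) :
      |‖ξ‖ ^ p + p * ‖ξ‖ ^ (p - 2) * ⟪ξ, v⟫ ^ 2| ≤ (1 + p) * (1 + ‖ξ‖ ^ k) := by
    rw [abs_of_nonneg (by positivity)]
    have h1 : ‖ξ‖ ^ (p - 2) * ⟪ξ, v⟫ ^ 2 ≤ ‖ξ‖ ^ p :=
      calc ‖ξ‖ ^ (p - 2) * ⟪ξ, v⟫ ^ 2 ≤ ‖ξ‖ ^ (p - 2) * ‖ξ‖ ^ 2 := by
            gcongr ?_ * ?_; exact sq_le_sq.2 ((hinner ξ).trans (le_abs_self _))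
        _ = ‖ξ‖ ^ p := norm_rpow_sub_two_mul_sq hp ξ
    have h2 := norm_rpow_le_one_add_pow hp.le hk ξ
    nlinarith
  have hm : AEStronglyMeasurable
      (fun ξ : Ed d => ‖ξ‖ ^ p + p * ‖ξ‖ ^ (p - 2) * ⟪ξ, v⟫ ^ 2) :=
    (hmeas.add ((hmeas.const_mul p).mul (by fun_prop))).aestronglyMeasurable
  simpa only [RCLike.re_eq_complex_re, re_ofReal_mul, mul_conj, ofReal_re, normSq_eq_norm_sq] using
    (integrable_growth_mul_schwartz_mul_conj hm hgrow f f).re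

/-- Integration by parts against the weight `‖ξ‖ ^ p * ⟪ξ, v⟫`. -/
lemma integral_norm_rpow_mul_inner_mul_re {d : ℕ} {p : ℝ} (hp : 0 < p) {v : Ed d} (hv : ‖v‖ = 1)
    (f : SchwartzMap (Ed d) ℂ) :
    2 * ∫ ξ, ‖ξ‖ ^ p * ⟪ξ, v⟫ * (∂_{v} f ξ * (starRingEnd ℂ) (f ξ)).re =
      -∫ ξ, (‖ξ‖ ^ p + p * ‖ξ‖ ^ (p - 2) * ⟪ξ, v⟫ ^ 2) * ‖f ξ‖ ^ 2 := by
  have hmeas {q : ℝ} : Measurable fun ξ : Ed d => ‖ξ‖ ^ q := by fun_prop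
  have hinner (ξ : Ed d) : |⟪ξ, v⟫| ≤ ‖ξ‖ := by simpa [hv] using abs_real_inner_le_norm ξ v
  obtain ⟨k, hk⟩ := exists_nat_ge (p + 1)
  have hgrow (ξ : Ed d) : |‖ξ‖ ^ p * ⟪ξ, v⟫| ≤ 1 * (1 + ‖ξ‖ ^ k) := by
    rw [abs_mul, abs_of_nonneg (by positivity), one_mul]
    calc ‖ξ‖ ^ p * |⟪ξ, v⟫| ≤ ‖ξ‖ ^ p * ‖ξ‖ := by gcongr; exact hinner ξ
      _ = ‖ξ‖ ^ (p + 1) := by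
        rw [Real.rpow_add_of_nonneg (norm_nonneg _) hp.le zero_le_one, Real.rpow_one]
      _ ≤ _ := norm_rpow_le_one_add_pow (by linarith) hk ξ
  have hm : AEStronglyMeasurable (fun ξ : Ed d => ‖ξ‖ ^ p * ⟪ξ, v⟫) :=
    (hmeas.mul (by fun_prop)).aestronglyMeasurable
  have hnorm (ξ : Ed d) : (f ξ * (starRingEnd ℂ) (f ξ)).re = ‖f ξ‖ ^ 2 := by
    rw [mul_conj, ofReal_re, normSq_eq_norm_sq]
  have hderiv (ξ : Ed d) : HasFDerivAt (fun η => ‖f η‖ ^ 2)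
      (2 • (innerSL ℝ (f ξ)).comp (fderiv ℝ f ξ)) ξ :=
    f.differentiableAt.hasFDerivAt.norm_sq
  have hre (ξ : Ed d) : (2 • (innerSL ℝ (f ξ)).comp (fderiv ℝ f ξ)) v =
      2 * (∂_{v} f ξ * (starRingEnd ℂ) (f ξ)).re := by
    simp [lineDerivOp_apply_eq_fderiv, Complex.inner]
    ring
  have parts := integral_bilinear_hasFDerivAt_right_eq_neg_left_of_integrable
    (μ := (volume : Measure (Ed d))) (B := ContinuousLinearMap.mul ℝ ℝ) (v := v)
    (f := fun ξ : Ed d => ‖ξ‖ ^ p * ⟪ξ, v⟫) (g := fun ξ => ‖f ξ‖ ^ 2)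
    (f' := fun ξ => ‖ξ‖ ^ p • innerSL ℝ v + (p * ‖ξ‖ ^ (p - 2) * ⟪ξ, v⟫) • innerSL ℝ ξ)
    (g' := fun ξ => 2 • (innerSL ℝ (f ξ)).comp (fderiv ℝ f ξ))
  have hf' (ξ : Ed d) :
      (‖ξ‖ ^ p • innerSL ℝ v + (p * ‖ξ‖ ^ (p - 2) * ⟪ξ, v⟫) • innerSL ℝ ξ) v =
        ‖ξ‖ ^ p + p * ‖ξ‖ ^ (p - 2) * ⟪ξ, v⟫ ^ 2 := by
    simp [hv]
    ring
  simp only [ContinuousLinearMap.mul_apply', hre, hf'] at parts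
  rw [← parts, ← integral_const_mul]
  · congr 1 with ξ
    ring
  · exact integrable_divergence_weight_mul_norm_sq hp hv f
  · refine (((integrable_growth_mul_schwartz_mul_conj hm hgrow (∂_{v} f) f).re).const_mul 2).congr
      (.of_forall fun ξ => ?_)
    simp only [RCLike.re_eq_complex_re, re_ofReal_mul]
    ring
  · simpa only [RCLike.re_eq_complex_re, re_ofReal_mul, hnorm] using
      (integrable_growth_mul_schwartz_mul_conj hm hgrow f f).re
  · exact fun ξ _ => hasFDerivAt_norm_rpow_mul_inner hp v ξ
  · exact fun ξ _ => hderiv ξ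

lemma HdotNorm_sq {d : ℕ} {s : ℝ} (hs : 0 < s) (f : SchwartzMap (Ed d) ℂ) :
    HdotNorm s f ^ 2 =
      (2 * Real.pi) ^ (-(d : ℝ)) * ∫ ξ, ‖ξ‖ ^ (2 * s) * ‖schwartzFT d f ξ‖ ^ 2 := by
  have hsq (ξ : Ed d) : ‖((‖ξ‖ ^ s : ℝ) : ℂ) * FT f ξ‖ ^ 2 =
      ‖ξ‖ ^ (2 * s) * ‖schwartzFT d f ξ‖ ^ 2 := by
    rw [norm_mul, mul_pow, norm_real, Real.norm_of_nonneg (by positivity), schwartzFT_apply,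
      mul_comm 2 s, Real.rpow_mul (norm_nonneg _), Real.rpow_two]
  have hcont : Continuous fun ξ : Ed d => ((‖ξ‖ ^ s : ℝ) : ℂ) * FT f ξ := by
    simp_rw [← schwartzFT_apply]
    have : Continuous fun ξ : Ed d => ‖ξ‖ ^ s := by fun_prop (disch := exact hs.le)
    fun_prop
  rw [HdotNorm, mul_pow, toReal_eLpNorm hcont.aestronglyMeasurable,
    lpNorm_eq_integral_norm_rpow_toReal two_ne_zero ENNReal.ofNat_ne_top
      hcont.aestronglyMeasurable, ← Real.rpow_two, ← Real.rpow_two,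
    ← Real.rpow_mul (by positivity), ← Real.rpow_mul (by positivity)]
  simp only [ENNReal.toReal_ofNat, Real.rpow_two, hsq]
  norm_num

theorem stmt16 (d : ℕ) (hd : 1 ≤ d) (s : ℝ) (hs0 : 0 < s) (hs1 : s < 1)
    (Q : SchwartzMap (Ed d) ℂ) :
    (∫ x : Ed d, (∑ j : Fin d, ((x j : ℝ) : ℂ) * pd j (⇑Q) x) *
        (starRingEnd ℂ) (fracD (2 * s) (⇑Q) x)).re
      = -(((d : ℝ) - 2 * s) / 2) * HdotNorm s (⇑Q) ^ 2 := by
  set P := schwartzFT d Q with hP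
  set e : Fin d → Ed d := fun j => EuclideanSpace.single j 1 with he
  have he_norm (j : Fin d) : ‖e j‖ = 1 := by simp [he]
  have he_inner (x : Ed d) (j : Fin d) : ⟪x, e j⟫ = x j := by
    simp [he, EuclideanSpace.inner_single_right]
  have hp : 0 < 2 * s := by positivity
  obtain ⟨k, hk⟩ := exists_nat_ge (2 * s)
  have hm {q : ℝ} : Measurable fun ξ : Ed d => ‖ξ‖ ^ q := by fun_prop
  have hgrow (ξ : Ed d) : |‖ξ‖ ^ (2 * s)| ≤ 1 * (1 + ‖ξ‖ ^ k) := by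
    rw [abs_of_nonneg (by positivity), one_mul]
    exact norm_rpow_le_one_add_pow hp.le hk ξ
  have hint (f : SchwartzMap (Ed d) ℂ) :=
    (integrable_growth_mul_schwartz_mul_conj hm.aestronglyMeasurable hgrow f P).re
  simp only [RCLike.re_eq_complex_re, re_ofReal_mul] at hint
  let G (j : Fin d) := smulLeftCLM ℂ (fun x : Ed d => ⟪x, e j⟫) (∂_{e j} Q)
  have hG (x : Ed d) : ∑ j, ((x j : ℝ) : ℂ) * pd j Q x = (∑ j, G j) x := by
    rw [_root_.sum_apply]
    refine Finset.sum_congr rfl fun j _ => ?_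
    rw [smulLeftCLM_apply_apply (hasTemperateGrowth_inner_right _), he_inner, real_smul]
    rfl
  have hGre (j : Fin d) (ξ : Ed d) :
      ‖ξ‖ ^ (2 * s) * (schwartzFT d (G j) ξ * (starRingEnd ℂ) (P ξ)).re =
        -(‖ξ‖ ^ (2 * s) * ‖P ξ‖ ^ 2) -
          ‖ξ‖ ^ (2 * s) * ⟪ξ, e j⟫ * (∂_{e j} P ξ * (starRingEnd ℂ) (P ξ)).re := by
    rw [schwartzFT_inner_smul_lineDerivOp, he_norm, ← normSq_eq_norm_sq, normSq_apply]
    simp [← hP]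
    ring
  have hPint : Integrable fun ξ => ‖ξ‖ ^ (2 * s) * ‖P ξ‖ ^ 2 := by
    simpa only [mul_conj, ofReal_re, normSq_eq_norm_sq] using hint P
  have hderiv (j : Fin d) : Integrable fun ξ =>
      ‖ξ‖ ^ (2 * s) * ⟪ξ, e j⟫ * (∂_{e j} P ξ * (starRingEnd ℂ) (P ξ)).re := by
    refine ((hPint.add (hint (schwartzFT d (G j)))).neg).congr (.of_forall fun ξ => ?_)
    simp only [Pi.neg_apply, Pi.add_apply, hGre]
    ring
  have hterm (j : Fin d) :
      ∫ ξ, ‖ξ‖ ^ (2 * s) * (schwartzFT d (G j) ξ * (starRingEnd ℂ) (P ξ)).re =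
        -(∫ ξ, ‖ξ‖ ^ (2 * s) * ‖P ξ‖ ^ 2) + 2⁻¹ * ∫ ξ,
          (‖ξ‖ ^ (2 * s) + 2 * s * ‖ξ‖ ^ (2 * s - 2) * ⟪ξ, e j⟫ ^ 2) * ‖P ξ‖ ^ 2 := by
    simp_rw [hGre]
    rw [integral_sub (by exact hPint.neg) (hderiv j), integral_neg]
    linarith [integral_norm_rpow_mul_inner_mul_re hp (he_norm j) P]
  have hweight (ξ : Ed d) :
      ∑ j, (‖ξ‖ ^ (2 * s) + 2 * s * ‖ξ‖ ^ (2 * s - 2) * ⟪ξ, e j⟫ ^ 2) * ‖P ξ‖ ^ 2 =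
        (d + 2 * s) * (‖ξ‖ ^ (2 * s) * ‖P ξ‖ ^ 2) := by
    have hsum : ∑ j, ⟪ξ, e j⟫ ^ 2 = ‖ξ‖ ^ 2 := by
      simp_rw [he_inner, EuclideanSpace.real_norm_sq_eq]
    rw [← Finset.sum_mul, Finset.sum_add_distrib, ← Finset.mul_sum, hsum, mul_assoc (2 * s),
      norm_rpow_sub_two_mul_sq hp]
    simp
    ring
  have hdiv : ∑ j, ∫ ξ,
      (‖ξ‖ ^ (2 * s) + 2 * s * ‖ξ‖ ^ (2 * s - 2) * ⟪ξ, e j⟫ ^ 2) * ‖P ξ‖ ^ 2 =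
        (d + 2 * s) * ∫ ξ, ‖ξ‖ ^ (2 * s) * ‖P ξ‖ ^ 2 := by
    rw [← integral_finsetSum _ fun j _ =>
      integrable_divergence_weight_mul_norm_sq hp (he_norm j) P]
    simp_rw [hweight]
    rw [integral_const_mul]
  have hfrac : Integrable fun ξ : Ed d => ((‖ξ‖ ^ (2 * s) : ℝ) : ℂ) * FT Q ξ := by
    simpa only [hP, schwartzFT_apply] using
      integrable_growth_mul_schwartz hm.aestronglyMeasurable hgrow P
  have hmul (ξ : Ed d) : FT (∑ j, G j : SchwartzMap (Ed d) ℂ) ξ *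
      (starRingEnd ℂ) (((‖ξ‖ ^ (2 * s) : ℝ) : ℂ) * FT Q ξ) =
        ((‖ξ‖ ^ (2 * s) : ℝ) : ℂ) *
          (schwartzFT d (∑ j, G j) ξ * (starRingEnd ℂ) (P ξ)) := by
    rw [hP, schwartzFT_apply, schwartzFT_apply, map_mul, conj_ofReal]
    ring
  simp_rw [hG, fracD]
  rw [integral_mul_conj_FTinv _ hfrac, re_ofReal_mul, HdotNorm_sq hs0]
  simp_rw [hmul]
  have hre := integral_re
    (integrable_growth_mul_schwartz_mul_conj hm.aestronglyMeasurable hgrow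
      (schwartzFT d (∑ j, G j)) P)
  simp only [RCLike.re_eq_complex_re, re_ofReal_mul] at hre
  have hsplit (ξ : Ed d) :
      ‖ξ‖ ^ (2 * s) * (schwartzFT d (∑ j, G j) ξ * (starRingEnd ℂ) (P ξ)).re =
        ∑ j, ‖ξ‖ ^ (2 * s) * (schwartzFT d (G j) ξ * (starRingEnd ℂ) (P ξ)).re := by
    rw [map_sum, _root_.sum_apply, Finset.sum_mul, re_sum, Finset.mul_sum]
  rw [← hre]
  simp_rw [hsplit]
  rw [integral_finsetSum _ fun j _ => hint (schwartzFT d (G j))]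
  simp_rw [hterm]
  rw [Finset.sum_add_distrib, ← Finset.mul_sum, hdiv]
  simp
  ring

end
end
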